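/- arXiv:2307.14496 — 4 statements merged into one kernel-verified Lean document; each statement's English description precedes it below -/
import Mathlib

section
/- Let $G=(V,E)$ be a finite graph on $n$ vertices and $w:V\to\mathbb{R}_{\ge0}$. Let $\mu_1\ge\cdots\ge\mu_n$ be the eigenvalues of the vertex-weighted Laplacian $L^w(G)$. Then for all $k\ge0$, the dimension of the $k$-th reduced homology group of the independence complex $I(G)$ with real coefficients satisfies $\dim \tilde H_k(I(G);\mathbb{R}) \le |\{I\subseteq\{1,\ldots,n\}: |I|=k+1,\ \sum_{i\in I}\mu_i \ge \sum_{v\in V}w(v)\}|$. -/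
open Matrix Polynomial

variable {V : Type*} [Fintype V] [DecidableEq V] [LinearOrder V]

/-- Faces of the independence complex of `G` of cardinality `k`
(i.e. independent sets of size `k`, of dimension `k-1`). -/
abbrev SimpleGraph.indepFace (G : SimpleGraph V) [DecidableRel G.Adj] (k : ℕ) :=
  {σ : Finset V // σ.card = k ∧ ∀ u ∈ σ, ∀ v ∈ σ, ¬ G.Adj u v}

/-- The simplicial boundary matrix of the independence complex, from chains on
faces of cardinality `k+1` to chains on faces of cardinality `k`. -/
noncomputable def SimpleGraph.indepBoundary (G : SimpleGraph V) [DecidableRel G.Adj] (k : ℕ) :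
    Matrix (G.indepFace k) (G.indepFace (k+1)) ℝ :=
  Matrix.of fun σ τ =>
    if σ.1 ⊆ τ.1 then ∑ v ∈ τ.1 \ σ.1, (-1 : ℝ) ^ ((τ.1.filter (· < v)).card) else 0

/-- `dim H̃_k(I(G); ℝ)`, the dimension of the `k`-th reduced homology group (with real
coefficients) of the independence complex of `G`. -/
noncomputable def SimpleGraph.indepHomologyDim (G : SimpleGraph V) [DecidableRel G.Adj]
    (k : ℕ) : ℕ :=
  Module.finrank ℝ (LinearMap.ker (G.indepBoundary k).mulVecLin) -
    Module.finrank ℝ (LinearMap.range (G.indepBoundary (k+1)).mulVecLin)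

/-- The vertex-weighted Laplacian `L^w(G)`. -/
noncomputable def SimpleGraph.wLap (G : SimpleGraph V) [DecidableRel G.Adj] (w : V → ℝ) :
    Matrix V V ℝ :=
  Matrix.of fun u v =>
    if u = v then ∑ u' ∈ G.neighborFinset u, w u'
    else if G.Adj u v then -w v else 0


namespace BettiIndep

/-- Sign of `v` relative to `σ`. -/
noncomputable def eps {n : ℕ} (v : Fin n) (σ : Finset (Fin n)) : ℝ :=
  (-1 : ℝ) ^ ((σ.filter (· < v)).card)

lemma eps_mul_self {n : ℕ} (v : Fin n) (σ : Finset (Fin n)) : eps v σ * eps v σ = 1 := by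
  unfold eps
  rw [← mul_pow]; norm_num

lemma eps_insert {n : ℕ} (u v : Fin n) (σ : Finset (Fin n)) (hv : v ∉ σ) :
    eps u (insert v σ) = (if v < u then -1 else 1) * eps u σ := by
  unfold eps
  rw [Finset.filter_insert]
  split_ifs with h
  · rw [Finset.card_insert_of_notMem (by simp [hv]), pow_succ]; ring
  · simp

lemma eps_insert_self {n : ℕ} (v : Fin n) (σ : Finset (Fin n)) :
    eps v (insert v σ) = eps v σ := by
  unfold eps
  rw [Finset.filter_insert]
  simp

lemma eps_erase_self {n : ℕ} (v : Fin n) (σ : Finset (Fin n)) :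
    eps v (σ.erase v) = eps v σ := by
  unfold eps
  congr 2
  ext a
  simp only [Finset.mem_filter, Finset.mem_erase]
  constructor
  · rintro ⟨⟨_, h⟩, h'⟩; exact ⟨h, h'⟩
  · rintro ⟨h, h'⟩; exact ⟨⟨h'.ne, h⟩, h'⟩

/-- annihilation operator -/
noncomputable def ann {n : ℕ} (v : Fin n) :
    (Finset (Fin n) → ℝ) →ₗ[ℝ] (Finset (Fin n) → ℝ) where
  toFun x := fun σ => if v ∈ σ then 0 else eps v σ * x (insert v σ)
  map_add' x y := by
    ext σ; by_cases h : v ∈ σ <;> simp [h, mul_add]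
  map_smul' c x := by
    ext σ; by_cases h : v ∈ σ <;> simp [h]; ring

/-- creation operator -/
noncomputable def cre {n : ℕ} (v : Fin n) (x : Finset (Fin n) → ℝ) : Finset (Fin n) → ℝ :=
  fun σ => if v ∈ σ then eps v σ * x (σ.erase v) else 0

lemma ann_apply {n : ℕ} (v : Fin n) (x : Finset (Fin n) → ℝ) (σ : Finset (Fin n)) :
    ann v x σ = if v ∈ σ then 0 else eps v σ * x (insert v σ) := rfl

lemma ann_ann {n : ℕ} (u v : Fin n) (x : Finset (Fin n) → ℝ) :
    ann u (ann v x) = - ann v (ann u x) := by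
  ext σ
  simp only [ann_apply, Pi.neg_apply]
  rcases eq_or_ne u v with rfl | huv
  · simp
  by_cases hu : u ∈ σ
  · simp [hu]
  by_cases hv : v ∈ σ
  · simp [hv]
  rw [Finset.insert_comm u v]
  simp only [hu, hv, huv, huv.symm, if_false, Finset.mem_insert, or_false,
    eps_insert _ _ _ hu, eps_insert _ _ _ hv]
  rcases lt_or_gt_of_ne huv with h | h
  · simp [h, h.not_gt]; ring
  · simp [h, h.not_gt]; ring

lemma cre_ann {n : ℕ} (u v : Fin n) (x : Finset (Fin n) → ℝ) (σ : Finset (Fin n)) :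
    cre u (ann v x) σ + ann v (cre u x) σ = if u = v then x σ else 0 := by
  simp only [ann_apply, cre]
  rcases eq_or_ne u v with rfl | huv
  · by_cases hu : u ∈ σ
    · simp [hu, eps_erase_self, ← mul_assoc, eps_mul_self]
    · simp [hu, eps_insert_self, ← mul_assoc, eps_mul_self]
  by_cases hu : u ∈ σ
  swap
  · simp [hu, huv]
  by_cases hv : v ∈ σ
  · simp [hv, huv, huv.symm]
  obtain ⟨ρ, hρ, rfl⟩ : ∃ ρ, u ∉ ρ ∧ σ = insert u ρ :=
    ⟨σ.erase u, by simp, (Finset.insert_erase hu).symm⟩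
  have hv' : v ∉ ρ := fun h => hv (by simp [h])
  rw [Finset.insert_comm v u, Finset.erase_insert hρ, Finset.erase_insert (by simp [hρ, huv]),
    Finset.insert_comm u v]
  simp only [hu, hv, hv', huv, if_false, if_true, Finset.mem_insert, or_true,
    eps_insert _ _ _ hρ, eps_insert _ _ _ hv]
  rcases lt_or_gt_of_ne huv with h | h
  · simp [h, h.not_gt]; ring
  · simp [h, h.not_gt]; ring

/-- inner product -/
noncomputable def ip {n : ℕ} (x y : Finset (Fin n) → ℝ) : ℝ := ∑ σ, x σ * y σ

lemma ip_comm {n : ℕ} (x y : Finset (Fin n) → ℝ) : ip x y = ip y x := by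
  simp [ip, mul_comm]

lemma ip_ann {n : ℕ} (v : Fin n) (x y : Finset (Fin n) → ℝ) :
    ip (ann v x) y = ip x (cre v y) := by
  unfold ip
  simp only [ann_apply, cre, ite_mul, mul_ite, zero_mul, mul_zero]
  rw [← Finset.sum_filter]
  have e : ∀ f : Finset (Fin n) → ℝ, (∑ σ, if v ∈ σ then 0 else f σ) = ∑ σ with v ∉ σ, f σ := by
    intro f
    rw [Finset.sum_filter]
    exact Finset.sum_congr rfl fun σ _ => by split_ifs <;> rfl
  rw [e]
  refine Finset.sum_nbij' (fun σ => insert v σ) (fun σ => σ.erase v) ?_ ?_ ?_ ?_ ?_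
  · simp
  · simp
  · intro σ hσ; exact Finset.erase_insert (by simpa using hσ)
  · intro σ hσ; exact Finset.insert_erase (by simpa using hσ)
  · intro σ hσ
    simp only [Finset.mem_filter, Finset.mem_univ, true_and] at hσ
    rw [Finset.erase_insert hσ, eps_insert_self]; ring

lemma ip_ann_ann {n : ℕ} (u v : Fin n) (x : Finset (Fin n) → ℝ) :
    ip (ann u x) (ann v x) + ip (cre u x) (cre v x) = if u = v then ip x x else 0 := by
  rw [ip_ann, ← ip_ann v, ip_comm (ann v _)]
  unfold ip
  rw [← Finset.sum_add_distrib]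
  simp only [← mul_add, cre_ann]
  split_ifs <;> simp

noncomputable def annF {n : ℕ} (f : Fin n → ℝ) :
    (Finset (Fin n) → ℝ) →ₗ[ℝ] (Finset (Fin n) → ℝ) := ∑ v, f v • ann v

lemma annF_apply {n : ℕ} (f : Fin n → ℝ) (x : Finset (Fin n) → ℝ) :
    annF f x = ∑ v, f v • ann v x := by
  simp [annF]

noncomputable def creF {n : ℕ} (f : Fin n → ℝ) (x : Finset (Fin n) → ℝ) :
    Finset (Fin n) → ℝ := ∑ v, f v • cre v x

lemma ip_sum_sum {n : ℕ} (f g : Fin n → ℝ) (x y : Fin n → Finset (Fin n) → ℝ) :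
    ip (∑ v, f v • x v) (∑ v, g v • y v) = ∑ u, ∑ v, f u * g v * ip (x u) (y v) := by
  unfold ip
  simp only [Finset.sum_apply, Pi.smul_apply, smul_eq_mul, Finset.sum_mul_sum]
  rw [Finset.sum_comm]
  refine Finset.sum_congr rfl fun u _ => ?_
  rw [Finset.sum_comm]
  simp only [Finset.mul_sum]
  refine Finset.sum_congr rfl fun v _ => ?_
  refine Finset.sum_congr rfl fun σ _ => ?_
  ring

lemma annF_annF {n : ℕ} (f g : Fin n → ℝ) (x : Finset (Fin n) → ℝ) :
    annF f (annF g x) = - annF g (annF f x) := by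
  simp only [annF_apply, map_sum, map_smul, Finset.smul_sum]
  rw [Finset.sum_comm, ← Finset.sum_neg_distrib]
  refine Finset.sum_congr rfl fun v _ => ?_
  rw [← Finset.sum_neg_distrib]
  refine Finset.sum_congr rfl fun u _ => ?_
  rw [ann_ann, smul_comm]; simp

lemma annF_self {n : ℕ} (f : Fin n → ℝ) (x : Finset (Fin n) → ℝ) :
    annF f (annF f x) = 0 := by
  have := annF_annF f f x
  exact self_eq_neg.mp this

lemma hodge {n : ℕ} (s : Fin n → ℝ) (x : Finset (Fin n) → ℝ) :
    ip (annF s x) (annF s x) + ip (creF s x) (creF s x) = (∑ v, s v ^ 2) * ip x x := by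
  rw [annF_apply, creF, ip_sum_sum, ip_sum_sum, ← Finset.sum_add_distrib, Finset.sum_mul]
  refine Finset.sum_congr rfl fun u _ => ?_
  rw [← Finset.sum_add_distrib]
  simp only [← mul_add, ip_ann_ann]
  simp only [mul_ite, mul_zero, Finset.sum_ite_eq, Finset.mem_univ, if_true]; ring

lemma number {n : ℕ} (m : ℕ) (x : Finset (Fin n) → ℝ) (hx : ∀ σ, x σ ≠ 0 → σ.card = m) :
    ∑ v, ip (ann v x) (ann v x) = m * ip x x := by
  have h : ∀ (v : Fin n) σ, cre v (ann v x) σ = if v ∈ σ then x σ else 0 := by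
    intro v σ
    simp only [cre, ann_apply]
    split_ifs with h1 h2
    · simp at h2
    · rw [Finset.insert_erase h1, eps_erase_self, ← mul_assoc, eps_mul_self, one_mul]
    · rfl
  simp only [ip_ann]
  unfold ip
  rw [Finset.sum_comm, Finset.mul_sum]
  refine Finset.sum_congr rfl fun σ _ => ?_
  simp only [h, mul_ite, mul_zero]
  by_cases h0 : x σ = 0
  · simp [h0]
  · simp [hx σ h0]

lemma annF_card {n : ℕ} (m : ℕ) (f : Fin n → ℝ) (x : Finset (Fin n) → ℝ)
    (hx : ∀ σ, x σ ≠ 0 → σ.card = m + 1) : ∀ σ, annF f x σ ≠ 0 → σ.card = m := by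
  intro σ h
  rw [annF_apply, Finset.sum_apply] at h
  obtain ⟨v, -, hv⟩ := Finset.exists_ne_zero_of_sum_ne_zero h
  rw [Pi.smul_apply, ann_apply] at hv
  by_cases h1 : v ∈ σ
  · simp [h1] at hv
  · have : x (insert v σ) ≠ 0 := by
      intro h2; simp [h2] at hv
    have := hx _ this
    rw [Finset.card_insert_of_notMem h1] at this
    omega

lemma sum_weight {n : ℕ} (g : Fin n → ℝ) (U : Fin n → Fin n → ℝ) (M : Matrix (Fin n) (Fin n) ℝ)
    (h : ∀ u v, ∑ i, g i * U i u * U i v = M u v) (x : Finset (Fin n) → ℝ) :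
    ∑ i, g i * ip (annF (U i) x) (annF (U i) x) = ∑ u, ∑ v, M u v * ip (ann u x) (ann v x) := by
  simp only [annF_apply, ip_sum_sum, Finset.mul_sum, ← h, Finset.sum_mul]
  rw [Finset.sum_comm]
  refine Finset.sum_congr rfl fun u _ => ?_
  rw [Finset.sum_comm]
  refine Finset.sum_congr rfl fun v _ => ?_
  refine Finset.sum_congr rfl fun σ _ => ?_
  ring

/-- transform -/
noncomputable def hat {n : ℕ} (U : Fin n → Fin n → ℝ) (l : List (Fin n)) :
    (Finset (Fin n) → ℝ) →ₗ[ℝ] (Finset (Fin n) → ℝ) :=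
  l.foldr (fun i T => T ∘ₗ annF (U i)) LinearMap.id

lemma hat_cons {n : ℕ} (U : Fin n → Fin n → ℝ) (i : Fin n) (l : List (Fin n))
    (x : Finset (Fin n) → ℝ) : hat U (i :: l) x = hat U l (annF (U i) x) := rfl

lemma hat_perm {n : ℕ} (U : Fin n → Fin n → ℝ) {l l' : List (Fin n)} (h : l.Perm l') :
    ∀ x, hat U l x = hat U l' x ∨ hat U l x = - hat U l' x := by
  induction h with
  | nil => intro x; left; rfl
  | cons a _ ih => intro x; simpa [hat_cons] using ih _
  | swap a b l => intro x; right; simp only [hat_cons]; rw [annF_annF, map_neg]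
  | trans _ _ ih1 ih2 =>
    intro x
    rcases ih1 x with h1 | h1 <;> rcases ih2 x with h2 | h2 <;> simp [h1, h2]

lemma hat_nodup {n : ℕ} (U : Fin n → Fin n → ℝ) (l : List (Fin n)) (h : ¬ l.Nodup)
    (x : Finset (Fin n) → ℝ) : hat U l x = 0 := by
  obtain ⟨a, ha⟩ : ∃ a, List.Sublist [a, a] l := by
    by_contra hc
    push Not at hc
    exact h (List.nodup_iff_sublist.mpr hc)
  obtain ⟨l', hl'⟩ := ha.exists_perm_append
  have h0 : hat U ([a, a] ++ l') x = 0 := by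
    simp [hat_cons, annF_self]
  rcases hat_perm U hl' x with h1 | h1 <;> rw [h1, h0]
  simp

lemma parseval {n : ℕ} (U : Fin n → Fin n → ℝ)
    (hU : ∀ u v, ∑ i, U i u * U i v = if u = v then 1 else 0) (m : ℕ) :
    ∀ (x : Finset (Fin n) → ℝ), (∀ σ, x σ ≠ 0 → σ.card = m) →
    ∑ i : Fin m → Fin n, (hat U (List.ofFn i) x ∅) ^ 2 = m.factorial * ip x x := by
  induction m with
  | zero =>
    intro x hx
    have : ip x x = x ∅ ^ 2 := by
      unfold ip
      rw [Finset.sum_eq_single ∅]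
      · ring
      · intro σ _ hσ
        have : x σ = 0 := by
          by_contra h
          exact hσ (by simpa using hx σ h)
        simp [this]
      · simp
    simp [this, hat]
  | succ m ih =>
    intro x hx
    rw [← (Fin.consEquiv (fun _ => Fin n)).sum_comp, Fintype.sum_prod_type]
    have h1 := sum_weight (fun _ => 1) U 1 (by intro u v; simp [hU, Matrix.one_apply]) x
    simp only [one_mul, Matrix.one_apply, ite_mul, zero_mul, Finset.sum_ite_eq,
      Finset.mem_univ, if_true] at h1
    rw [number _ x hx] at h1
    calc _ = ∑ i, (m.factorial : ℝ) * ip (annF (U i) x) (annF (U i) x) := by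
          refine Finset.sum_congr rfl fun i _ => ?_
          rw [← ih _ (annF_card m _ x hx)]
          simp [Fin.consEquiv, List.ofFn_succ, hat_cons]
      _ = _ := by
          rw [← Finset.mul_sum, h1, Nat.factorial_succ]; push_cast; ring

lemma parseval_weight {n : ℕ} (U : Fin n → Fin n → ℝ)
    (hU : ∀ u v, ∑ i, U i u * U i v = if u = v then 1 else 0) (m : ℕ) (g : Fin n → ℝ)
    (M : Matrix (Fin n) (Fin n) ℝ)
    (h : ∀ u v, ∑ i, g i * U i u * U i v = M u v)
    (x : Finset (Fin n) → ℝ) (hx : ∀ σ, x σ ≠ 0 → σ.card = m + 1) :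
    ∑ i : Fin (m + 1) → Fin n, (∑ j, g (i j)) * (hat U (List.ofFn i) x ∅) ^ 2
      = (m + 1).factorial * ∑ u, ∑ v, M u v * ip (ann u x) (ann v x) := by
  have h0 : ∑ i : Fin (m + 1) → Fin n, g (i 0) * (hat U (List.ofFn i) x ∅) ^ 2
      = m.factorial * ∑ u, ∑ v, M u v * ip (ann u x) (ann v x) := by
    rw [← (Fin.consEquiv (fun _ => Fin n)).sum_comp, Fintype.sum_prod_type,
      ← sum_weight g U M h x, Finset.mul_sum]
    refine Finset.sum_congr rfl fun i _ => ?_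
    rw [mul_left_comm, ← parseval U hU m _ (annF_card m _ x hx), Finset.mul_sum]
    simp [Fin.consEquiv, List.ofFn_succ, hat_cons]
  have h1 : ∀ j : Fin (m + 1), ∑ i : Fin (m + 1) → Fin n, g (i j) * (hat U (List.ofFn i) x ∅) ^ 2
      = ∑ i : Fin (m + 1) → Fin n, g (i 0) * (hat U (List.ofFn i) x ∅) ^ 2 := by
    intro j
    refine Fintype.sum_equiv (Equiv.arrowCongr (Equiv.swap 0 j) (Equiv.refl _)) _ _ fun i => ?_
    have e : (Equiv.arrowCongr (Equiv.swap 0 j) (Equiv.refl (Fin n))) i = i ∘ (Equiv.swap 0 j) := by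
      ext a; simp [Equiv.arrowCongr]
    rw [e]
    have hp := hat_perm U (Equiv.Perm.ofFn_comp_perm (Equiv.swap 0 j) i) x
    have h2 : (hat U (List.ofFn (i ∘ Equiv.swap 0 j)) x ∅) ^ 2 = (hat U (List.ofFn i) x ∅) ^ 2 := by
      rcases hp with hp | hp <;> rw [hp]
      rw [Pi.neg_apply, neg_sq]
    rw [h2]
    simp only [Function.comp_apply, Equiv.swap_apply_left]
  simp only [Finset.sum_mul]
  rw [Finset.sum_comm]
  simp only [h1, h0]
  simp [Nat.factorial_succ]; ring

lemma dim_bound {n : ℕ} (U : Fin n → Fin n → ℝ)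
    (hU : ∀ u v, ∑ i, U i u * U i v = if u = v then 1 else 0) (m : ℕ) (g : Fin n → ℝ)
    (M : Matrix (Fin n) (Fin n) ℝ)
    (h : ∀ u v, ∑ i, g i * U i u * U i v = M u v) (c : ℝ)
    (H : Submodule ℝ (Finset (Fin n) → ℝ)) (hH : ∀ x ∈ H, ∀ σ, x σ ≠ 0 → σ.card = m + 1)
    (hq : ∀ x ∈ H, c * ip x x ≤ ∑ u, ∑ v, M u v * ip (ann u x) (ann v x)) :
    Module.finrank ℝ H ≤ ((Finset.univ.powersetCard (m+1)).filter
        (fun s : Finset (Fin n) => c ≤ ∑ i ∈ s, g i)).card := by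
  set good := (Finset.univ.powersetCard (m+1)).filter
        (fun s : Finset (Fin n) => c ≤ ∑ i ∈ s, g i) with hgood
  let φ : H →ₗ[ℝ] (good → ℝ) := LinearMap.pi fun s =>
    (LinearMap.proj (∅ : Finset (Fin n))) ∘ₗ (hat U (s.1.sort (· ≤ ·))) ∘ₗ H.subtype
  have hφ : Function.Injective φ := by
    rw [← LinearMap.ker_eq_bot, LinearMap.ker_eq_bot']
    rintro ⟨x, hx⟩ h0
    have h0' : ∀ s ∈ good, hat U (s.sort (· ≤ ·)) x ∅ = 0 := fun s hs => congrFun h0 ⟨s, hs⟩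
    have hsgn : ∀ i : Fin (m + 1) → Fin n, hat U (List.ofFn i) x ∅ ≠ 0 → ∑ j, g (i j) < c := by
      intro i hi
      by_contra hc
      push Not at hc
      have hnd : (List.ofFn i).Nodup := by
        by_contra hnd
        rw [hat_nodup U _ hnd] at hi
        exact hi rfl
      have hinj : Function.Injective i := List.nodup_ofFn.mp hnd
      have hs : Finset.univ.image i ∈ good := by
        rw [hgood, Finset.mem_filter, Finset.mem_powersetCard]
        refine ⟨⟨Finset.subset_univ _, ?_⟩, ?_⟩
        · rw [Finset.card_image_of_injective _ hinj]; simp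
        · rw [Finset.sum_image (fun a _ b _ hab => hinj hab)]; exact hc
      have hp : (List.ofFn i).Perm ((Finset.univ.image i).sort (· ≤ ·)) := by
        rw [List.perm_ext_iff_of_nodup hnd (Finset.sort_nodup _ _)]
        intro a
        rw [List.mem_ofFn', Finset.mem_sort]
        simp
      apply hi
      rcases hat_perm U hp x with h1 | h1 <;> rw [h1]
      · exact h0' _ hs
      · rw [Pi.neg_apply, h0' _ hs, neg_zero]
    have h1 := parseval U hU (m + 1) x (hH x hx)
    have h2 := parseval_weight U hU m g M h x (hH x hx)
    have h3 : 0 ≤ ∑ i : Fin (m + 1) → Fin n,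
        (∑ j, g (i j) - c) * (hat U (List.ofFn i) x ∅) ^ 2 := by
      simp only [sub_mul, Finset.sum_sub_distrib, ← Finset.mul_sum]
      rw [h1, h2]
      have := hq x hx
      have hf : (0 : ℝ) ≤ (m + 1).factorial := by positivity
      nlinarith [mul_le_mul_of_nonneg_left this hf]
    have h4 : ∀ i ∈ (Finset.univ : Finset (Fin (m + 1) → Fin n)),
        (∑ j, g (i j) - c) * (hat U (List.ofFn i) x ∅) ^ 2 ≤ 0 := by
      intro i _
      by_cases hi : hat U (List.ofFn i) x ∅ = 0
      · rw [hi]; simp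
      · exact mul_nonpos_of_nonpos_of_nonneg (by linarith [hsgn i hi]) (sq_nonneg _)
    have h5 := (Finset.sum_eq_zero_iff_of_nonpos h4).mp (le_antisymm (Finset.sum_nonpos h4) h3)
    have h6 : ∀ i : Fin (m + 1) → Fin n, hat U (List.ofFn i) x ∅ = 0 := by
      intro i
      by_contra hi
      rcases mul_eq_zero.mp (h5 i (Finset.mem_univ _)) with h7 | h7
      · linarith [hsgn i hi]
      · exact hi (pow_eq_zero_iff (two_ne_zero) |>.mp h7)
    have h7 : ip x x = 0 := by
      simp only [h6] at h1
      have hf : ((m + 1).factorial : ℝ) ≠ 0 := by positivity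
      simpa [hf] using h1.symm
    have h8 : x = 0 := by
      ext σ
      have := (Finset.sum_eq_zero_iff_of_nonneg (fun σ _ => mul_self_nonneg (x σ))).mp h7 σ
        (Finset.mem_univ _)
      simpa using this
    exact Subtype.ext h8
  have := LinearMap.finrank_le_finrank_of_injective hφ
  simpa using this

/-- symmetrised weighted Laplacian -/
noncomputable def symLap {n : ℕ} (G : SimpleGraph (Fin n)) [DecidableRel G.Adj] (s : Fin n → ℝ) :
    Matrix (Fin n) (Fin n) ℝ :=
  Matrix.of fun u v => (if u = v then ∑ t, if G.Adj u t then s t ^ 2 else 0 else 0) -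
    if G.Adj u v then s u * s v else 0

lemma symLap_quad {n : ℕ} (G : SimpleGraph (Fin n)) [DecidableRel G.Adj] (s : Fin n → ℝ)
    (x : Finset (Fin n) → ℝ) :
    ∑ u, ∑ v, symLap G s u v * ip (ann u x) (ann v x) =
    1 / 2 * ∑ u, ∑ v, if G.Adj u v then ∑ ρ, (s v * ann u x ρ - s u * ann v x ρ) ^ 2 else 0 := by
  have e : ∀ u v, (if G.Adj u v then ∑ ρ, (s v * ann u x ρ - s u * ann v x ρ) ^ 2 else 0) =
      (if G.Adj u v then s v ^ 2 else 0) * ip (ann u x) (ann u x)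
      + (if G.Adj v u then s u ^ 2 else 0) * ip (ann v x) (ann v x)
      - 2 * ((if G.Adj u v then s u * s v else 0) * ip (ann u x) (ann v x)) := by
    intro u v
    simp only [G.adj_comm v u]
    split_ifs with h
    · unfold ip
      simp only [Finset.mul_sum, ← Finset.sum_add_distrib, ← Finset.sum_sub_distrib]
      exact Finset.sum_congr rfl fun ρ _ => by ring
    · simp
  simp only [e, Finset.sum_add_distrib, Finset.sum_sub_distrib, symLap, Matrix.of_apply, sub_mul]
  rw [Finset.sum_comm (f := fun u v => (if G.Adj v u then s u ^ 2 else 0) * ip (ann v x) (ann v x))]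
  simp only [← Finset.mul_sum]
  have e2 : ∀ u, (∑ v, (if u = v then ∑ t, if G.Adj u t then s t ^ 2 else 0 else 0) *
      ip (ann u x) (ann v x)) = ∑ v, (if G.Adj u v then s v ^ 2 else 0) *
      ip (ann u x) (ann u x) := by
    intro u
    rw [← Finset.sum_mul]
    simp only [ite_mul _ _ _ (ip _ _), zero_mul, Finset.sum_ite_eq, Finset.mem_univ, if_true]
  simp only [e2]
  ring

lemma cre_edge {n : ℕ} (s : Fin n → ℝ) (x : Finset (Fin n) → ℝ) (u v : Fin n) (huv : u ≠ v)
    (τ : Finset (Fin n)) (hu : u ∈ τ) (hv : v ∈ τ)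
    (hx : ∀ σ, u ∈ σ → v ∈ σ → x σ = 0) :
    creF s x τ ^ 2 = (s v * ann u x ((τ.erase u).erase v) - s u * ann v x ((τ.erase u).erase v)) ^ 2
    := by
  have h1 : creF s x τ = s u * (eps u τ * x (τ.erase u)) + s v * (eps v τ * x (τ.erase v)) := by
    rw [creF, Finset.sum_apply, ← Finset.sum_subset (Finset.subset_univ {u, v}),
      Finset.sum_pair huv]
    · simp [cre, hu, hv]
    · intro t _ ht
      simp only [Finset.mem_insert, Finset.mem_singleton, not_or] at ht
      rw [Pi.smul_apply, cre, hx (τ.erase t) (by simp [hu, Ne.symm ht.1])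
        (by simp [hv, Ne.symm ht.2])]
      simp
  obtain ⟨ρ, hρ, hρ', rfl⟩ : ∃ ρ, u ∉ ρ ∧ v ∉ ρ ∧ τ = insert u (insert v ρ) :=
    ⟨(τ.erase u).erase v, by simp, by simp, by
      rw [Finset.insert_erase (by simp [hv, huv.symm]), Finset.insert_erase hu]⟩
  have e1 : (insert u (insert v ρ)).erase u = insert v ρ :=
    Finset.erase_insert (by simp [hρ, huv])
  have e2 : (insert u (insert v ρ)).erase v = insert u ρ := by
    rw [Finset.insert_comm, Finset.erase_insert (by simp [hρ', huv.symm])]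
  rw [h1, e1, e2, Finset.erase_insert hρ', ann_apply, ann_apply, if_neg hρ, if_neg hρ',
    eps_insert_self, eps_insert _ _ _ hρ', Finset.insert_comm, eps_insert_self,
    eps_insert _ _ _ hρ]
  have a := eps_mul_self u ρ
  have b := eps_mul_self v ρ
  set A := eps u ρ
  set B := eps v ρ
  set X := x (insert u ρ)
  set Y := x (insert v ρ)
  have a2 : A ^ 2 = 1 := by rw [sq, a]
  have b2 : B ^ 2 = 1 := by rw [sq, b]
  rcases lt_or_gt_of_ne huv with h | h
  · simp only [h, h.not_gt, if_true, if_false]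
    ring_nf; rw [a2, b2]; ring
  · simp only [h, h.not_gt, if_true, if_false]
    ring_nf; rw [a2, b2]; ring

lemma sum_erase_le {n : ℕ} (u v : Fin n) (huv : u ≠ v) (f : Finset (Fin n) → ℝ)
    (hf0 : ∀ ρ, 0 ≤ f ρ) :
    (∑ τ : Finset (Fin n), if u ∈ τ ∧ v ∈ τ then f ((τ.erase u).erase v) else 0) ≤ ∑ ρ, f ρ := by
  have k : ∀ τ : Finset (Fin n), u ∈ τ ∧ v ∈ τ →
      insert u (insert v ((τ.erase u).erase v)) = τ := by
    intro τ hτ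
    rw [Finset.insert_erase (by simp [hτ.2, huv.symm]), Finset.insert_erase hτ.1]
  have hinj : Set.InjOn (fun τ : Finset (Fin n) => (τ.erase u).erase v)
      (Finset.univ.filter fun τ : Finset (Fin n) => u ∈ τ ∧ v ∈ τ : Finset (Finset (Fin n))) := by
    intro τ hτ τ' hτ' h
    have h1 := (Finset.mem_filter.mp hτ).2
    have h2 := (Finset.mem_filter.mp hτ').2
    have h3 : (τ.erase u).erase v = (τ'.erase u).erase v := h
    rw [← k τ h1, ← k τ' h2, h3]
  rw [← Finset.sum_filter, ← Finset.sum_image hinj]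
  exact Finset.sum_le_sum_of_subset_of_nonneg (Finset.subset_univ _) (fun ρ _ _ => hf0 ρ)

lemma graph_ineq {n : ℕ} (G : SimpleGraph (Fin n)) [DecidableRel G.Adj] (s : Fin n → ℝ)
    (x : Finset (Fin n) → ℝ) (hx : ∀ σ, x σ ≠ 0 → ∀ u ∈ σ, ∀ v ∈ σ, ¬ G.Adj u v)
    (hδ : ∀ τ : Finset (Fin n), (∀ u ∈ τ, ∀ v ∈ τ, ¬ G.Adj u v) → creF s x τ = 0) :
    ip (creF s x) (creF s x) ≤ ∑ u, ∑ v, symLap G s u v * ip (ann u x) (ann v x) := by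
  rw [symLap_quad]
  obtain ⟨f, hf⟩ : ∃ f : Fin n → Fin n → Finset (Fin n) → ℝ, ∀ u v ρ,
    (s v * ann u x ρ - s u * ann v x ρ) ^ 2 = f u v ρ := ⟨_, fun _ _ _ => rfl⟩
  have hf0 : ∀ u v ρ, 0 ≤ f u v ρ := fun u v ρ => by rw [← hf]; exact sq_nonneg _
  simp only [hf]
  have step1 : ∀ τ, creF s x τ * creF s x τ ≤ 1 / 2 * ∑ u, ∑ v,
      if G.Adj u v ∧ u ∈ τ ∧ v ∈ τ then f u v ((τ.erase u).erase v) else 0 := by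
    intro τ
    have hnn : ∀ u v, 0 ≤ if G.Adj u v ∧ u ∈ τ ∧ v ∈ τ then f u v ((τ.erase u).erase v) else 0 := by
      intro u v; split_ifs
      · exact hf0 _ _ _
      · exact le_rfl
    by_cases hτ : ∀ u ∈ τ, ∀ v ∈ τ, ¬ G.Adj u v
    · rw [hδ τ hτ]
      simp only [mul_zero]
      exact mul_nonneg (by norm_num) (Finset.sum_nonneg fun u _ => Finset.sum_nonneg fun v _ => hnn u v)
    · push Not at hτ
      obtain ⟨u, hu, v, hv, huv⟩ := hτ
      have e1 := cre_edge s x u v huv.ne τ hu hv (fun σ h1 h2 => by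
        by_contra h; exact hx σ h u h1 v h2 huv)
      have e2 := cre_edge s x v u huv.ne' τ hv hu (fun σ h1 h2 => by
        by_contra h; exact hx σ h v h1 u h2 huv.symm)
      have i1 : ∀ a b, (if G.Adj a b ∧ a ∈ τ ∧ b ∈ τ then f a b ((τ.erase a).erase b) else 0) ≤
          ∑ c, if G.Adj a c ∧ a ∈ τ ∧ c ∈ τ then f a c ((τ.erase a).erase c) else 0 := fun a b =>
        Finset.single_le_sum (f := fun c =>
          if G.Adj a c ∧ a ∈ τ ∧ c ∈ τ then f a c ((τ.erase a).erase c) else 0)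
          (fun c _ => hnn a c) (Finset.mem_univ b)
      have i2 := Finset.sum_le_sum_of_subset_of_nonneg (Finset.subset_univ ({u, v} : Finset (Fin n)))
        (f := fun a => ∑ c, if G.Adj a c ∧ a ∈ τ ∧ c ∈ τ then f a c ((τ.erase a).erase c) else 0)
        (fun a _ _ => Finset.sum_nonneg fun c _ => hnn a c)
      rw [Finset.sum_pair huv.ne] at i2
      have j1 := i1 u v
      have j2 := i1 v u
      rw [if_pos ⟨huv, hu, hv⟩] at j1
      rw [if_pos ⟨huv.symm, hv, hu⟩] at j2
      rw [hf] at e1 e2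
      rw [← e1] at j1
      rw [← e2] at j2
      rw [← sq]
      linarith
  calc ip (creF s x) (creF s x) ≤ ∑ τ : Finset (Fin n), 1 / 2 * ∑ u, ∑ v,
      (if G.Adj u v ∧ u ∈ τ ∧ v ∈ τ then f u v ((τ.erase u).erase v) else 0) :=
        Finset.sum_le_sum fun τ _ => step1 τ
    _ = 1 / 2 * ∑ u, ∑ v, ∑ τ : Finset (Fin n),
      (if G.Adj u v ∧ u ∈ τ ∧ v ∈ τ then f u v ((τ.erase u).erase v) else 0) := by
        rw [← Finset.mul_sum, Finset.sum_comm]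
        congr 1
        exact Finset.sum_congr rfl fun u _ => Finset.sum_comm
    _ ≤ _ := by
        refine mul_le_mul_of_nonneg_left ?_ (by norm_num)
        refine Finset.sum_le_sum fun u _ => Finset.sum_le_sum fun v _ => ?_
        by_cases huv : G.Adj u v
        swap
        · simp [huv]
        simp only [huv, true_and, if_true]
        exact sum_erase_le u v huv.ne (f u v) (hf0 u v)

/-- weighted boundary entries on all finsets -/
noncomputable def bd {n : ℕ} (s : Fin n → ℝ) (σ τ : Finset (Fin n)) : ℝ :=
  ∑ v, if v ∉ σ ∧ insert v σ = τ then s v * eps v σ else 0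

lemma annF_bd {n : ℕ} (s : Fin n → ℝ) (x : Finset (Fin n) → ℝ) (σ : Finset (Fin n)) :
    annF s x σ = ∑ τ, bd s σ τ * x τ := by
  simp only [annF_apply, Finset.sum_apply, bd, Finset.sum_mul]
  rw [Finset.sum_comm]
  refine Finset.sum_congr rfl fun v _ => ?_
  rw [Finset.sum_eq_single (insert v σ)]
  · by_cases h : v ∈ σ <;> simp [ann_apply, h]; ring
  · intro τ _ h
    rw [if_neg (fun h' => h h'.2.symm), zero_mul]
  · simp

lemma creF_bd {n : ℕ} (s : Fin n → ℝ) (x : Finset (Fin n) → ℝ) (τ : Finset (Fin n)) :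
    creF s x τ = ∑ σ, bd s σ τ * x σ := by
  simp only [creF, Finset.sum_apply, bd, Finset.sum_mul]
  rw [Finset.sum_comm]
  refine Finset.sum_congr rfl fun v _ => ?_
  rw [Finset.sum_eq_single (τ.erase v)]
  · by_cases h : v ∈ τ
    · simp [cre, h, Finset.insert_erase h, eps_erase_self]; ring
    · rw [if_neg]
      · simp [cre, h]
      · rintro ⟨_, h2⟩
        apply h; rw [← h2]; simp
  · intro σ _ h
    rw [if_neg, zero_mul]
    rintro ⟨h1, rfl⟩
    exact h (Finset.erase_insert h1).symm
  · simp

lemma bd_prod {n : ℕ} (s : Fin n → ℝ) (σ τ : Finset (Fin n)) :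
    (∏ v ∈ σ, s v) * bd s σ τ = bd 1 σ τ * ∏ v ∈ τ, s v := by
  simp only [bd, Finset.sum_mul, Finset.mul_sum]
  refine Finset.sum_congr rfl fun v _ => ?_
  split_ifs with h
  · rw [← h.2, Finset.prod_insert h.1]; simp; ring
  · simp

/-- weighted boundary matrix -/
noncomputable def wB {n : ℕ} (G : SimpleGraph (Fin n)) [DecidableRel G.Adj] (s : Fin n → ℝ)
    (k : ℕ) : Matrix (G.indepFace k) (G.indepFace (k+1)) ℝ :=
  Matrix.of fun σ τ => bd s σ.1 τ.1

lemma wB_one {n : ℕ} (G : SimpleGraph (Fin n)) [DecidableRel G.Adj] (k : ℕ) :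
    wB G 1 k = G.indepBoundary k := by
  ext ⟨σ, hσ, hσ'⟩ ⟨τ, hτ, hτ'⟩
  simp only [wB, SimpleGraph.indepBoundary, Matrix.of_apply, bd, Pi.one_apply, one_mul]
  split_ifs with h
  · rw [← Finset.sum_filter]
    refine Finset.sum_congr ?_ ?_
    · ext v
      simp only [Finset.mem_filter, Finset.mem_univ, true_and, Finset.mem_sdiff]
      constructor
      · rintro ⟨h1, rfl⟩; exact ⟨by simp, h1⟩
      · rintro ⟨h1, h2⟩
        refine ⟨h2, Finset.eq_of_subset_of_card_le (Finset.insert_subset h1 h) ?_⟩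
        rw [Finset.card_insert_of_notMem h2]; omega
    · intro v hv
      simp only [Finset.mem_sdiff] at hv
      have e : insert v σ = τ := by
        refine Finset.eq_of_subset_of_card_le (Finset.insert_subset hv.1 h) ?_
        rw [Finset.card_insert_of_notMem hv.2]; omega
      rw [← e, ← eps_insert_self]; rfl
  · refine Finset.sum_eq_zero fun v _ => ?_
    rw [if_neg]
    rintro ⟨_, rfl⟩
    exact h (Finset.subset_insert _ _)

lemma rank_wB_of_ne {n : ℕ} (G : SimpleGraph (Fin n)) [DecidableRel G.Adj] (s : Fin n → ℝ)
    (hs : ∀ v, s v ≠ 0) (k : ℕ) : (wB G s k).rank ≤ (G.indepBoundary k).rank := by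
  have : wB G s k = Matrix.diagonal (fun σ : G.indepFace k => (∏ v ∈ σ.1, s v)⁻¹) *
      G.indepBoundary k * Matrix.diagonal (fun σ : G.indepFace (k+1) => ∏ v ∈ σ.1, s v) := by
    rw [← wB_one]
    ext σ τ
    rw [Matrix.mul_diagonal, Matrix.diagonal_mul, mul_assoc]
    simp only [wB, Matrix.of_apply]
    rw [← bd_prod, inv_mul_cancel_left₀]
    exact Finset.prod_ne_zero_iff.mpr fun v _ => hs v
  rw [this]
  exact (Matrix.rank_mul_le_left _ _).trans (Matrix.rank_mul_le_right _ _)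

lemma isOpen_rank {m n : Type*} [Fintype m] [Fintype n] [DecidableEq n] (r : ℕ) :
    IsOpen {A : Matrix m n ℝ | r ≤ A.rank} := by
  let T : Matrix m n ℝ →ₗ[ℝ] ((n → ℝ) →L[ℝ] (m → ℝ)) :=
    (LinearMap.toContinuousLinearMap.toLinearMap) ∘ₗ (Matrix.toLin').toLinearMap
  have hT : Continuous T := T.continuous_of_finiteDimensional
  have h := (isOpen_setOfPred_nat_le_rank (𝕜 := ℝ) (E := n → ℝ) (F := m → ℝ) r).preimage hT
  convert h using 1
  ext A
  change r ≤ A.rank ↔ (r : Cardinal) ≤ LinearMap.rank (A.mulVecLin)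
  rw [Matrix.rank, LinearMap.rank, ← Module.finrank_eq_rank]
  exact Nat.cast_le.symm

lemma rank_wB {n : ℕ} (G : SimpleGraph (Fin n)) [DecidableRel G.Adj] (s : Fin n → ℝ)
    (hs : ∀ v, 0 ≤ s v) (k : ℕ) : (wB G s k).rank ≤ (G.indepBoundary k).rank := by
  classical
  let F : ℝ → Matrix (G.indepFace k) (G.indepFace (k+1)) ℝ := fun t => wB G (fun v => s v + t) k
  have hF : Continuous F := by
    refine continuous_matrix fun σ τ => ?_
    simp only [F, wB, Matrix.of_apply, bd]
    refine continuous_finsetSum _ fun v _ => ?_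
    split_ifs
    · fun_prop
    · fun_prop
  have ho : IsOpen {t | (wB G s k).rank ≤ (F t).rank} := (isOpen_rank _).preimage hF
  have h0 : (0 : ℝ) ∈ {t | (wB G s k).rank ≤ (F t).rank} := by simp [F]
  obtain ⟨ε, hε, hb⟩ := Metric.isOpen_iff.mp ho 0 h0
  have h1 : ε / 2 ∈ Metric.ball (0 : ℝ) ε := by
    simp [abs_of_pos hε]; linarith
  exact (hb h1).trans (rank_wB_of_ne G _ (fun v => by have := hs v; positivity) k)

/-- extension by zero -/
noncomputable def ext0 {n : ℕ} (G : SimpleGraph (Fin n)) [DecidableRel G.Adj] (k : ℕ) :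
    (G.indepFace k → ℝ) →ₗ[ℝ] (Finset (Fin n) → ℝ) where
  toFun y σ := if h : σ.card = k ∧ ∀ u ∈ σ, ∀ v ∈ σ, ¬ G.Adj u v then y ⟨σ, h⟩ else 0
  map_add' x y := by ext σ; simp only [Pi.add_apply]; split_ifs <;> simp
  map_smul' c x := by ext σ; simp only [Pi.smul_apply, RingHom.id_apply]; split_ifs <;> simp

lemma ext0_coe {n : ℕ} (G : SimpleGraph (Fin n)) [DecidableRel G.Adj] (k : ℕ)
    (y : G.indepFace k → ℝ) (σ : G.indepFace k) : ext0 G k y σ.1 = y σ := by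
  simp only [ext0, LinearMap.coe_mk, AddHom.coe_mk]
  rw [dif_pos σ.2]

lemma ext0_ne {n : ℕ} (G : SimpleGraph (Fin n)) [DecidableRel G.Adj] (k : ℕ)
    (y : G.indepFace k → ℝ) (σ : Finset (Fin n)) (h : ext0 G k y σ ≠ 0) :
    σ.card = k ∧ ∀ u ∈ σ, ∀ v ∈ σ, ¬ G.Adj u v := by
  by_contra hc
  apply h
  simp only [ext0, LinearMap.coe_mk, AddHom.coe_mk]
  rw [dif_neg hc]

lemma ext0_injective {n : ℕ} (G : SimpleGraph (Fin n)) [DecidableRel G.Adj] (k : ℕ) :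
    Function.Injective (ext0 G k) := by
  intro x y h
  ext σ
  rw [← ext0_coe G k x, h, ext0_coe]

lemma sum_ext0 {n : ℕ} (G : SimpleGraph (Fin n)) [DecidableRel G.Adj] (k : ℕ)
    (y : G.indepFace k → ℝ) (g : Finset (Fin n) → ℝ) :
    ∑ σ, g σ * ext0 G k y σ = ∑ σ : G.indepFace k, g σ.1 * y σ := by
  rw [← Finset.sum_filter_of_ne
    (p := fun σ : Finset (Fin n) => σ.card = k ∧ ∀ u ∈ σ, ∀ v ∈ σ, ¬ G.Adj u v)]
  · rw [Finset.sum_subtype (p := fun σ : Finset (Fin n) =>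
      σ.card = k ∧ ∀ u ∈ σ, ∀ v ∈ σ, ¬ G.Adj u v) _ (by simp)]
    refine Finset.sum_congr rfl fun σ _ => ?_
    rw [ext0_coe]
  · intro σ _ h
    exact ext0_ne G k y σ (right_ne_zero_of_mul h)

lemma harmonic {n : ℕ} (G : SimpleGraph (Fin n)) [DecidableRel G.Adj] (s : Fin n → ℝ) (k : ℕ)
    (y : G.indepFace (k+1) → ℝ) (h1 : wB G s k *ᵥ y = 0) (h2 : (wB G s (k+1))ᵀ *ᵥ y = 0) :
    (∑ v, s v ^ 2) * ip (ext0 G (k+1) y) (ext0 G (k+1) y) ≤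
      ∑ u, ∑ v, symLap G s u v * ip (ann u (ext0 G (k+1) y)) (ann v (ext0 G (k+1) y)) := by
  set x := ext0 G (k+1) y with hx
  have hd : annF s x = 0 := by
    ext σ
    by_contra h
    have h' := h
    simp only [Pi.zero_apply] at h
    have hc := annF_card k s x (fun σ hσ => (ext0_ne G _ y σ hσ).1) σ h
    rw [annF_apply, Finset.sum_apply] at h
    obtain ⟨v, -, hv⟩ := Finset.exists_ne_zero_of_sum_ne_zero h
    rw [Pi.smul_apply, ann_apply] at hv
    have hxv : x (insert v σ) ≠ 0 := by
      intro h2; simp [h2] at hv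
    have hi := (ext0_ne G _ y _ hxv).2
    apply h'
    rw [annF_bd, hx, sum_ext0]
    exact congrFun h1 ⟨σ, hc, fun u hu v hv => hi u (by simp [hu]) v (by simp [hv])⟩
  have hδ : ∀ τ : Finset (Fin n), (∀ u ∈ τ, ∀ v ∈ τ, ¬ G.Adj u v) → creF s x τ = 0 := by
    intro τ hτ
    by_cases hc : τ.card = k + 1 + 1
    · rw [creF_bd, hx, sum_ext0]
      exact congrFun h2 ⟨τ, hc, hτ⟩
    · rw [creF, Finset.sum_apply]
      refine Finset.sum_eq_zero fun v _ => ?_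
      rw [Pi.smul_apply, cre]
      split_ifs with hv
      · have : x (τ.erase v) = 0 := by
          by_contra h
          have := (ext0_ne G _ y _ h).1
          rw [Finset.card_erase_of_mem hv] at this
          omega
        simp [this]
      · simp
  rw [← hodge, hd]
  have := graph_ineq G s x (fun σ hσ => (ext0_ne G _ y σ hσ).2) hδ
  have h0 : ip (0 : Finset (Fin n) → ℝ) 0 = 0 := by simp [ip]
  rw [h0, zero_add]
  exact this

lemma betti_le_harm {n : ℕ} (G : SimpleGraph (Fin n)) [DecidableRel G.Adj] (s : Fin n → ℝ)
    (hs : ∀ v, 0 ≤ s v) (k : ℕ) :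
    G.indepHomologyDim k ≤ Module.finrank ℝ
      ((LinearMap.ker (wB G s k).mulVecLin ⊓ LinearMap.ker (wB G s (k+1))ᵀ.mulVecLin :
        Submodule ℝ (G.indepFace (k+1) → ℝ))) := by
  unfold SimpleGraph.indepHomologyDim
  have r1 := rank_wB G s hs k
  have r2 := rank_wB G s hs (k+1)
  have a1 := LinearMap.finrank_range_add_finrank_ker (G.indepBoundary k).mulVecLin
  have a2 := LinearMap.finrank_range_add_finrank_ker (wB G s k).mulVecLin
  have a3 := LinearMap.finrank_range_add_finrank_ker (wB G s (k+1))ᵀ.mulVecLin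
  have a4 := Submodule.finrank_sup_add_finrank_inf_eq (LinearMap.ker (wB G s k).mulVecLin)
    (LinearMap.ker (wB G s (k+1))ᵀ.mulVecLin)
  have a5 := Submodule.finrank_le (LinearMap.ker (wB G s k).mulVecLin ⊔
    LinearMap.ker (wB G s (k+1))ᵀ.mulVecLin)
  have a6 : Module.finrank ℝ (LinearMap.range (wB G s (k+1))ᵀ.mulVecLin) = (wB G s (k+1)).rank :=
    Matrix.rank_transpose _
  unfold Matrix.rank at *
  have key : Module.finrank ℝ (LinearMap.ker (G.indepBoundary k).mulVecLin) -
    Module.finrank ℝ (LinearMap.range (G.indepBoundary (k+1)).mulVecLin) ≤ Module.finrank ℝ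
      ((LinearMap.ker (wB G s k).mulVecLin ⊓ LinearMap.ker (wB G s (k+1))ᵀ.mulVecLin :
        Submodule ℝ (G.indepFace (k+1) → ℝ))) := by omega
  convert key

lemma charpoly_sym {n : ℕ} (d s : Fin n → ℝ) (A : Matrix (Fin n) (Fin n) ℝ) :
    (diagonal d - A * (diagonal s * diagonal s)).charpoly =
      (diagonal d - diagonal s * A * diagonal s).charpoly := by
  refine Polynomial.eq_of_infinite_eval_eq _ _ ?_
  refine Set.Infinite.mono ?_ (Set.finite_range d).infinite_compl
  intro t ht
  change _ = _
  rw [Matrix.eval_charpoly, Matrix.eval_charpoly]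
  have hne : ∀ i, t - d i ≠ 0 := fun i h => ht ⟨i, by linarith⟩
  set T : Matrix (Fin n) (Fin n) ℝ := diagonal fun i => t - d i with hT
  set T' : Matrix (Fin n) (Fin n) ℝ := diagonal fun i => (t - d i)⁻¹ with hT'
  set S : Matrix (Fin n) (Fin n) ℝ := diagonal s
  have hTT : T * T' = 1 := by
    rw [hT, hT', diagonal_mul_diagonal, ← diagonal_one]
    congr 1; ext i; exact mul_inv_cancel₀ (hne i)
  have hcomm : S * T' = T' * S := by
    simp only [S, hT', diagonal_mul_diagonal, mul_comm]
  have hsc : Matrix.scalar (Fin n) t - diagonal d = T := by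
    rw [hT, Matrix.scalar_apply, diagonal_sub]
  have e1 : Matrix.scalar (Fin n) t - (diagonal d - A * (S * S)) = T * (1 + (T' * A * S) * S) := by
    have : T * (T' * A * S * S) = (T * T') * (A * (S * S)) := by simp only [mul_assoc]
    rw [mul_add, mul_one, this, hTT, one_mul, ← hsc]; abel
  have e2 : Matrix.scalar (Fin n) t - (diagonal d - S * A * S) = T * (1 + S * (T' * A * S)) := by
    have : T * (S * (T' * A * S)) = (T * T') * (S * A * S) := by
      rw [← mul_assoc S, ← mul_assoc S, hcomm]; simp only [mul_assoc]
    rw [mul_add, mul_one, this, hTT, one_mul, ← hsc]; abel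
  rw [e1, e2, det_mul, det_mul, det_one_add_mul_comm]

lemma charpoly_wLap {n : ℕ} (G : SimpleGraph (Fin n)) [DecidableRel G.Adj] (w s : Fin n → ℝ)
    (hs : ∀ v, s v ^ 2 = w v) : (G.wLap w).charpoly = (symLap G s).charpoly := by
  have h := charpoly_sym (fun u => ∑ t, if G.Adj u t then s t ^ 2 else 0) s (G.adjMatrix ℝ)
  convert h using 2
  · ext u v
    rw [diagonal_mul_diagonal, Matrix.sub_apply, Matrix.mul_diagonal]
    simp only [SimpleGraph.wLap, Matrix.of_apply, diagonal_apply, SimpleGraph.adjMatrix_apply]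
    rcases eq_or_ne u v with rfl | huv
    · simp [hs, ← Finset.sum_filter, SimpleGraph.neighborFinset_eq_filter]
    · simp [huv, ← hs]; split_ifs <;> simp; ring
  · ext u v
    rw [Matrix.sub_apply, Matrix.mul_diagonal, Matrix.diagonal_mul]
    simp only [symLap, Matrix.of_apply, diagonal_apply, SimpleGraph.adjMatrix_apply]
    split_ifs <;> simp

lemma symLap_herm {n : ℕ} (G : SimpleGraph (Fin n)) [DecidableRel G.Adj] (s : Fin n → ℝ) :
    (symLap G s).IsHermitian := by
  ext u v
  simp only [Matrix.conjTranspose_apply, symLap, Matrix.of_apply, star_trivial]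
  rcases eq_or_ne u v with rfl | huv
  · simp
  · simp [huv, huv.symm, G.adj_comm v u, mul_comm]

lemma exists_perm {n : ℕ} (f g : Fin n → ℝ)
    (h : ∏ i, (X - C (f i)) = ∏ i, (X - C (g i))) : ∃ π : Equiv.Perm (Fin n), f = g ∘ π := by
  have h1 : Multiset.map f Finset.univ.val = Multiset.map g Finset.univ.val := by
    have e : ∀ f : Fin n → ℝ, (∏ i, (X - C (f i))).roots = Multiset.map f Finset.univ.val := by
      intro f
      have := Polynomial.roots_multiset_prod_X_sub_C (Multiset.map f Finset.univ.val)
      rw [Multiset.map_map] at this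
      exact this
    rw [← e, ← e, h]
  rw [Fin.univ_val_map, Fin.univ_val_map, Multiset.coe_eq_coe] at h1
  have h2 : (List.ofFn (f ∘ Tuple.sort f)).Perm (List.ofFn (g ∘ Tuple.sort g)) :=
    ((Equiv.Perm.ofFn_comp_perm _ _).trans h1).trans (Equiv.Perm.ofFn_comp_perm _ _).symm
  have h3 : List.ofFn (f ∘ Tuple.sort f) = List.ofFn (g ∘ Tuple.sort g) :=
    h2.eq_of_sortedLE (Tuple.monotone_sort f).sortedLE_ofFn (Tuple.monotone_sort g).sortedLE_ofFn
  have h4 := List.ofFn_injective h3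
  refine ⟨(Tuple.sort f).symm.trans (Tuple.sort g), ?_⟩
  ext i
  have := congrFun h4 ((Tuple.sort f).symm i)
  simpa using this

lemma exists_basis {n : ℕ} (M : Matrix (Fin n) (Fin n) ℝ) (hM : M.IsHermitian) (μ : Fin n → ℝ)
    (hc : M.charpoly = ∏ i, (X - C (μ i))) : ∃ U : Fin n → Fin n → ℝ,
    (∀ u v, ∑ i, U i u * U i v = if u = v then 1 else 0) ∧
    (∀ u v, ∑ i, μ i * U i u * U i v = M u v) := by
  obtain ⟨π, hπ⟩ := exists_perm μ hM.eigenvalues (by rw [← hc, hM.charpoly_eq]; rfl)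
  let W : Matrix (Fin n) (Fin n) ℝ := hM.eigenvectorUnitary
  refine ⟨fun i v => W v (π i), ?_, ?_⟩
  · intro u v
    rw [Equiv.sum_comp π (fun i => W u i * W v i)]
    have : W * star W = 1 := Unitary.mul_star_self_of_mem hM.eigenvectorUnitary.2
    have := congrFun (congrFun this u) v
    rw [Matrix.mul_apply, Matrix.one_apply] at this
    simpa [Matrix.star_apply] using this
  · intro u v
    simp only [hπ, Function.comp_apply]
    rw [Equiv.sum_comp π (fun i => hM.eigenvalues i * W u i * W v i)]
    have := congrFun (congrFun hM.spectral_theorem u) v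
    rw [this, Unitary.conjStarAlgAut_apply, Matrix.mul_apply]
    refine Finset.sum_congr rfl fun i _ => ?_
    rw [Matrix.mul_diagonal, Matrix.star_apply]
    simp only [W, Function.comp_apply, RCLike.ofReal_real_eq_id, id_eq, star_trivial]; ring

end BettiIndep

/-- Let `G` be a graph on `n` vertices, `w : V → ℝ≥0`, and let
`μ 0 ≥ μ 1 ≥ ⋯ ≥ μ (n-1)` be the eigenvalues of the vertex-weighted Laplacian `L^w(G)`
(with multiplicity). Then for every `k ≥ 0`,
`dim H̃_k(I(G); ℝ) ≤ #{I ⊆ [n] : |I| = k+1, ∑_{i ∈ I} μ i ≥ ∑_v w v}`. -/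
theorem betti_indep_le {n : ℕ} (G : SimpleGraph (Fin n)) [DecidableRel G.Adj]
    (w : Fin n → ℝ) (hw : ∀ v, 0 ≤ w v) (μ : Fin n → ℝ) (hμ : Antitone μ)
    (hc : (G.wLap w).charpoly = ∏ i, (X - C (μ i))) (k : ℕ) :
    G.indepHomologyDim k ≤
      ((Finset.univ.powersetCard (k+1)).filter
        (fun s => ∑ v : Fin n, w v ≤ ∑ i ∈ s, μ i)).card := by
  have hs : ∀ v, (fun v => Real.sqrt (w v)) v ^ 2 = w v := fun v => Real.sq_sqrt (hw v)
  have hs0 : ∀ v, 0 ≤ (fun v => Real.sqrt (w v)) v := fun v => Real.sqrt_nonneg _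
  generalize (fun v => Real.sqrt (w v)) = s at hs hs0
  rw [BettiIndep.charpoly_wLap G w s hs] at hc
  obtain ⟨U, hU, hU'⟩ := BettiIndep.exists_basis _ (BettiIndep.symLap_herm G s) μ hc
  refine (BettiIndep.betti_le_harm G s hs0 k).trans ?_
  rw [(Submodule.equivMapOfInjective (BettiIndep.ext0 G (k+1))
    (BettiIndep.ext0_injective G (k+1)) _).finrank_eq]
  have := BettiIndep.dim_bound U hU k μ _ hU' (∑ v, s v ^ 2)
  simp only [hs] at this
  apply this
  · rintro x ⟨y, -, rfl⟩ σ hσ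
    exact (BettiIndep.ext0_ne G _ y σ hσ).1
  · rintro x ⟨y, ⟨h1, h2⟩, rfl⟩
    have := BettiIndep.harmonic G s k y h1 h2
    simpa only [hs] using this
end

section
/- Let $G=(V,E)$ be a finite graph with Laplacian eigenvalues $\lambda_1\ge\cdots\ge\lambda_{|V|}=0$. If $k$ is the minimal number such that $\lambda_1+\cdots+\lambda_k\ge|V|$, then $\tilde H_i(I(G);\mathbb{R})=0$ for all $i\le k-2$. -/
open Matrix Polynomial

variable {V : Type*} [Fintype V] [DecidableEq V] [LinearOrder V]

section helpers
variable {n : ℕ}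

noncomputable def sgF (v : Fin n) (ρ : Finset (Fin n)) : ℝ := (-1) ^ ((ρ.filter (· < v)).card)

noncomputable def annF (x : Finset (Fin n) → ℝ) (v : Fin n) (ρ : Finset (Fin n)) : ℝ :=
  if v ∈ ρ then 0 else sgF v ρ * x (insert v ρ)

noncomputable def creF (x : Finset (Fin n) → ℝ) (v : Fin n) (ρ : Finset (Fin n)) : ℝ :=
  if v ∈ ρ then sgF v ρ * x (ρ.erase v) else 0

def togF (v : Fin n) (ρ : Finset (Fin n)) : Finset (Fin n) := if v ∈ ρ then ρ.erase v else insert v ρ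

lemma togF_inv (v : Fin n) : Function.Involutive (togF v) := by
  intro ρ
  by_cases h : v ∈ ρ
  · simp [togF, h, Finset.insert_erase h]
  · simp [togF, h, Finset.erase_insert h]

lemma sum_togF (v : Fin n) (f : Finset (Fin n) → ℝ) : ∑ ρ, f (togF v ρ) = ∑ ρ, f ρ :=
  Equiv.sum_comp (togF_inv v).toPerm f

lemma sgF_sq (v : Fin n) (ρ : Finset (Fin n)) : sgF v ρ * sgF v ρ = 1 := by
  rw [sgF, ← mul_pow]; simp

lemma sgF_insert (u v : Fin n) (ρ : Finset (Fin n)) (h : v ∉ ρ) :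
    sgF u (insert v ρ) = if v < u then - sgF u ρ else sgF u ρ := by
  unfold sgF
  rw [Finset.filter_insert]
  split_ifs with h1
  · rw [Finset.card_insert_of_notMem (by simp [h]), pow_succ]; ring
  · rfl

lemma annF_tog (x : Finset (Fin n) → ℝ) (v : Fin n) (ρ : Finset (Fin n)) :
    annF x v (togF v ρ) * annF x v (togF v ρ) = if v ∈ ρ then x ρ * x ρ else 0 := by
  by_cases h : v ∈ ρ
  · simp only [annF, togF, h, if_true, Finset.notMem_erase, if_false, Finset.insert_erase h]
    linear_combination (x ρ * x ρ) * sgF_sq v (ρ.erase v)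
  · simp [annF, togF, h]

lemma creF_tog (x : Finset (Fin n) → ℝ) (v : Fin n) (ρ : Finset (Fin n)) :
    creF x v (togF v ρ) * creF x v (togF v ρ) = if v ∈ ρ then 0 else x ρ * x ρ := by
  by_cases h : v ∈ ρ
  · simp [creF, togF, h]
  · simp only [creF, togF, h, if_false, Finset.mem_insert_self, if_true, Finset.erase_insert h]
    linear_combination (x ρ * x ρ) * sgF_sq v (insert v ρ)

lemma car_same (x : Finset (Fin n) → ℝ) (v : Fin n) :
    ∑ ρ, annF x v ρ * annF x v ρ + ∑ ρ, creF x v ρ * creF x v ρ = ∑ ρ, x ρ * x ρ := by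
  rw [← sum_togF v (fun ρ => annF x v ρ * annF x v ρ),
    ← sum_togF v (fun ρ => creF x v ρ * creF x v ρ), ← Finset.sum_add_distrib]
  refine Finset.sum_congr rfl fun ρ _ => ?_
  rw [annF_tog, creF_tog]
  split_ifs <;> simp

lemma car_diff (x : Finset (Fin n) → ℝ) (u v : Fin n) (huv : u ≠ v) :
    ∑ ρ, annF x u ρ * annF x v ρ + ∑ ρ, creF x u ρ * creF x v ρ = 0 := by
  rw [← sum_togF u (fun ρ => creF x u ρ * creF x v ρ),
    ← sum_togF v (fun ρ => creF x u (togF u ρ) * creF x v (togF u ρ)), ← Finset.sum_add_distrib]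
  refine Finset.sum_eq_zero fun ρ _ => ?_
  by_cases hu : u ∈ ρ
  · by_cases hv : v ∈ ρ
    · simp [annF, creF, togF, hu, hv, huv]
    · simp [annF, creF, togF, hu, hv, huv]
  · by_cases hv : v ∈ ρ
    · simp [annF, creF, togF, hu, hv, huv, huv.symm]
    · have hu' : u ∉ insert v ρ := by simp [hu, huv]
      have hv' : v ∉ insert u ρ := by simp [hv, huv.symm]
      have e1 : togF u (togF v ρ) = insert u (insert v ρ) := by simp [togF, hu, hv, huv]
      have e2 : (insert u (insert v ρ)).erase u = insert v ρ := Finset.erase_insert hu'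
      have e3 : (insert u (insert v ρ)).erase v = insert u ρ := by
        rw [Finset.insert_comm]; exact Finset.erase_insert hv'
      have e4 : sgF u (insert u (insert v ρ)) = sgF u (insert v ρ) := by
        rw [sgF_insert _ _ _ hu']; simp
      have e5 : sgF v (insert u (insert v ρ)) = sgF v (insert u ρ) := by
        rw [Finset.insert_comm, sgF_insert _ _ _ hv']; simp
      simp only [annF, creF, hu, hv, if_false, e1, e2, e3, e4, e5, Finset.mem_insert_self, if_true,
        Finset.mem_insert, or_true]
      rw [sgF_insert _ _ _ hv, sgF_insert _ _ _ hu]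
      rcases lt_or_gt_of_ne huv with h | h
      · simp [h, not_lt_of_gt h]; ring
      · simp [h, not_lt_of_gt h]; ring

/-- smeared anticommutation relation -/
lemma car_smear (x : Finset (Fin n) → ℝ) (w : Fin n → ℝ) :
    ∑ ρ, (∑ v, w v * annF x v ρ) ^ 2 + ∑ ρ, (∑ v, w v * creF x v ρ) ^ 2
      = (∑ v, w v ^ 2) * ∑ ρ, x ρ * x ρ := by
  have key : ∀ f : Fin n → Finset (Fin n) → ℝ, ∑ ρ, (∑ v, w v * f v ρ) ^ 2
      = ∑ u, ∑ v, w u * w v * ∑ ρ, f u ρ * f v ρ := by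
    intro f
    simp_rw [sq, Finset.sum_mul_sum, Finset.mul_sum]
    rw [Finset.sum_comm]
    refine Finset.sum_congr rfl fun u _ => ?_
    rw [Finset.sum_comm]
    refine Finset.sum_congr rfl fun v _ => Finset.sum_congr rfl fun ρ _ => ?_
    ring
  rw [key, key, ← Finset.sum_add_distrib, Finset.sum_mul]
  refine Finset.sum_congr rfl fun u _ => ?_
  rw [← Finset.sum_add_distrib, Finset.sum_eq_single u]
  · rw [← mul_add, car_same]; ring
  · intro v _ hv
    rw [← mul_add, car_diff x u v hv.symm, mul_zero]
  · simp

lemma number_op (x : Finset (Fin n) → ℝ) (m : ℕ) (hx : ∀ σ, x σ ≠ 0 → σ.card = m) :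
    ∑ v, ∑ ρ, annF x v ρ ^ 2 = m * ∑ ρ, x ρ * x ρ := by
  have : ∀ v, ∑ ρ, annF x v ρ ^ 2 = ∑ ρ, if v ∈ ρ then x ρ * x ρ else 0 := by
    intro v
    rw [← sum_togF v]
    refine Finset.sum_congr rfl fun ρ _ => ?_
    rw [sq, annF_tog]
  simp_rw [this]
  rw [Finset.sum_comm, Finset.mul_sum]
  refine Finset.sum_congr rfl fun ρ _ => ?_
  rw [Finset.sum_ite_mem]
  by_cases h : x ρ = 0
  · simp [h]
  · simp [hx ρ h]

lemma edge_bound (G : SimpleGraph (Fin n)) (x : Finset (Fin n) → ℝ)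
    (hx : ∀ σ, x σ ≠ 0 → ∀ u ∈ σ, ∀ v ∈ σ, ¬ G.Adj u v) (u v : Fin n) (huv : G.Adj u v)
    (ρ : Finset (Fin n)) (hu : u ∉ ρ) (hv : v ∉ ρ) :
    (∑ w, creF x w (insert u (insert v ρ))) ^ 2 = (annF x u ρ - annF x v ρ) ^ 2 := by
  have hne := huv.ne
  have hu' : u ∉ insert v ρ := by simp [hu, hne]
  have hv' : v ∉ insert u ρ := by simp [hv, hne.symm]
  have e2 : (insert u (insert v ρ)).erase u = insert v ρ := Finset.erase_insert hu'
  have e3 : (insert u (insert v ρ)).erase v = insert u ρ := by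
    rw [Finset.insert_comm]; exact Finset.erase_insert hv'
  have e4 : sgF u (insert u (insert v ρ)) = sgF u (insert v ρ) := by
    rw [sgF_insert _ _ _ hu']; simp
  have e5 : sgF v (insert u (insert v ρ)) = sgF v (insert u ρ) := by
    rw [Finset.insert_comm, sgF_insert _ _ _ hv']; simp
  have hs : ∑ w, creF x w (insert u (insert v ρ))
      = creF x u (insert u (insert v ρ)) + creF x v (insert u (insert v ρ)) := by
    rw [← Finset.sum_pair (f := fun w => creF x w (insert u (insert v ρ))) hne]
    symm
    apply Finset.sum_subset (Finset.subset_univ _)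
    intro w _ hw
    simp only [Finset.mem_insert, Finset.mem_singleton, not_or] at hw
    unfold creF
    split_ifs with h
    · have : x ((insert u (insert v ρ)).erase w) = 0 := by
        by_contra h0
        refine hx _ h0 u ?_ v ?_ huv
        · simp [Ne.symm hw.1]
        · simp [Ne.symm hw.2]
      rw [this, mul_zero]
    · rfl
  rw [hs]
  simp only [annF, creF, hu, hv, if_false, e2, e3, e4, e5, Finset.mem_insert_self, if_true,
        Finset.mem_insert, or_true]
  rw [sgF_insert _ _ _ hv, sgF_insert _ _ _ hu]
  have hu2 := sgF_sq u ρ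
  have hv2 := sgF_sq v ρ
  generalize sgF u ρ = a at *
  generalize sgF v ρ = b at *
  rcases lt_or_gt_of_ne hne with h | h
  · simp only [h, not_lt_of_gt h, if_true, if_false]
    linear_combination (x (insert v ρ) ^ 2 - x (insert u ρ) ^ 2) * (hu2 - hv2)
  · simp only [h, not_lt_of_gt h, if_true, if_false]
    linear_combination (x (insert v ρ) ^ 2 - x (insert u ρ) ^ 2) * (hu2 - hv2)

lemma up_bound (G : SimpleGraph (Fin n)) [DecidableRel G.Adj] (x : Finset (Fin n) → ℝ)
    (hx : ∀ σ, x σ ≠ 0 → ∀ u ∈ σ, ∀ v ∈ σ, ¬ G.Adj u v)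
    (h0 : ∀ τ : Finset (Fin n), (∀ u ∈ τ, ∀ v ∈ τ, ¬ G.Adj u v) → ∑ w, creF x w τ = 0) :
    ∑ τ, (∑ w, creF x w τ) ^ 2 ≤
      ∑ ρ, (∑ u, ∑ v, if G.Adj u v then (annF x u ρ - annF x v ρ) ^ 2 else 0) / 2 := by
  have step : ∀ τ, (∑ w, creF x w τ) ^ 2 ≤ (∑ u, ∑ v, if G.Adj u v ∧ u ∈ τ ∧ v ∈ τ then
      (annF x u (togF u (togF v τ)) - annF x v (togF u (togF v τ))) ^ 2 else 0) / 2 := by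
    intro τ
    by_cases hf : ∀ u ∈ τ, ∀ v ∈ τ, ¬ G.Adj u v
    · rw [h0 τ hf]
      have : 0 ≤ (∑ u, ∑ v, if G.Adj u v ∧ u ∈ τ ∧ v ∈ τ then
        (annF x u (togF u (togF v τ)) - annF x v (togF u (togF v τ))) ^ 2 else 0) :=
        Finset.sum_nonneg fun _ _ => Finset.sum_nonneg fun _ _ => by split_ifs <;> positivity
      linarith
    · push Not at hf
      obtain ⟨u, hu, v, hv, huv⟩ := hf
      have main : ∀ u v, G.Adj u v → u ∈ τ → v ∈ τ → (∑ w, creF x w τ) ^ 2 =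
          (annF x u (togF u (togF v τ)) - annF x v (togF u (togF v τ))) ^ 2 := by
        intro u v huv hu hv
        have e : togF u (togF v τ) = (τ.erase v).erase u := by
          simp [togF, hu, hv, huv.ne]
        rw [e, ← edge_bound G x hx u v huv _ (by simp) (by simp)]
        have e' : insert u (insert v ((τ.erase v).erase u)) = τ := by
          ext w
          rw [Finset.mem_insert, Finset.mem_insert, Finset.mem_erase, Finset.mem_erase]
          grind
        rw [e']
      set f : Fin n × Fin n → ℝ := fun p => if G.Adj p.1 p.2 ∧ p.1 ∈ τ ∧ p.2 ∈ τ then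
        (annF x p.1 (togF p.1 (togF p.2 τ)) - annF x p.2 (togF p.1 (togF p.2 τ))) ^ 2 else 0 with hfd
      have hle : ∑ p ∈ {(u, v), (v, u)}, f p ≤ ∑ p, f p :=
        Finset.sum_le_sum_of_subset_of_nonneg (Finset.subset_univ _) fun p _ _ => by
          simp only [hfd]; split_ifs <;> positivity
      rw [Finset.sum_pair (by simp [huv.ne]), Fintype.sum_prod_type] at hle
      have f1 : f (u, v) = (∑ w, creF x w τ) ^ 2 := by
        simp only [hfd]; rw [if_pos ⟨huv, hu, hv⟩, main u v huv hu hv]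
      have f2 : f (v, u) = (∑ w, creF x w τ) ^ 2 := by
        simp only [hfd]; rw [if_pos ⟨huv.symm, hv, hu⟩, main v u huv.symm hv hu]
      rw [f1, f2] at hle
      linarith
  refine (Finset.sum_le_sum fun τ _ => step τ).trans ?_
  rw [← Finset.sum_div, ← Finset.sum_div]
  refine div_le_div_of_nonneg_right ?_ (by norm_num)
  rw [Finset.sum_comm, Finset.sum_comm (s := Finset.univ (α := Finset (Fin n)))]
  refine Finset.sum_le_sum fun u _ => ?_
  rw [Finset.sum_comm, Finset.sum_comm (s := Finset.univ (α := Finset (Fin n)))]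
  refine Finset.sum_le_sum fun v _ => ?_
  rw [← sum_togF u (fun ρ => if G.Adj u v then (annF x u ρ - annF x v ρ) ^ 2 else 0),
    ← sum_togF v (fun ρ => if G.Adj u v then (annF x u (togF u ρ) - annF x v (togF u ρ)) ^ 2 else 0)]
  refine Finset.sum_le_sum fun τ _ => ?_
  by_cases h : G.Adj u v
  · simp only [h, true_and, if_true]
    split_ifs
    · rfl
    · positivity
  · simp [h]

end helpers

section helpers2
variable {n : ℕ}

lemma exists_perm_of_prod_eq (f g : Fin n → ℝ)
    (h : ∏ i, (X - C (f i)) = ∏ i, (X - C (g i))) : ∃ e : Fin n ≃ Fin n, ∀ i, g (e i) = f i := by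
  have hr : Multiset.map f Finset.univ.val = Multiset.map g Finset.univ.val := by
    have := congrArg Polynomial.roots h
    rw [Polynomial.roots_prod _ _ (by simp [Finset.prod_ne_zero_iff, Polynomial.X_sub_C_ne_zero]),
      Polynomial.roots_prod _ _ (by simp [Finset.prod_ne_zero_iff, Polynomial.X_sub_C_ne_zero])]
      at this
    simpa using this
  have hc : ∀ c, Nonempty ({a // f a = c} ≃ {a // g a = c}) := by
    intro c
    have := congrArg (Multiset.count c) hr
    rw [Multiset.count_map, Multiset.count_map] at this
    refine ⟨Fintype.equivOfCardEq ?_⟩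
    rw [Fintype.card_subtype, Fintype.card_subtype]
    simp only [eq_comm (b := c)] 
    simp only [eq_comm (a := c)] at this ⊢
    exact this
  have e := fun c => (hc c).some
  exact ⟨Equiv.ofFiberEquiv e, fun i => Equiv.ofFiberEquiv_map e i⟩

lemma weighted_bound (lam γ : Fin n → ℝ) (hlam : Antitone lam) (M : ℝ) (m : ℕ) (hm : 1 ≤ m)
    (hmn : m ≤ n) (h0 : ∀ i, 0 ≤ γ i) (h1 : ∀ i, γ i ≤ M) (hs : ∑ i, γ i = m * M) :
    ∑ i, lam i * γ i ≤ (∑ i ∈ Finset.univ.filter (fun i : Fin n => (i : ℕ) < m), lam i) * M := by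
  set t := lam ⟨m - 1, by omega⟩ with ht
  have key : ∀ i, (lam i - t) * γ i ≤ if (i : ℕ) < m then (lam i - t) * M else 0 := by
    intro i
    split_ifs with h
    · have : t ≤ lam i := hlam (by rw [Fin.le_def]; simp only; omega)
      exact mul_le_mul_of_nonneg_left (h1 i) (by linarith)
    · have : lam i ≤ t := hlam (by rw [Fin.le_def]; simp only; omega)
      exact mul_nonpos_of_nonpos_of_nonneg (by linarith) (h0 i)
  have hsum := Finset.sum_le_sum fun i (_ : i ∈ Finset.univ) => key i
  rw [← Finset.sum_filter, ← Finset.sum_mul, Finset.sum_sub_distrib] at hsum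
  have hcard : (Finset.univ.filter (fun i : Fin n => (i : ℕ) < m)).card = m := by
    simp [Fin.card_filter_val_lt, hmn]
  simp only [sub_mul, Finset.sum_sub_distrib, Finset.sum_const, hcard, nsmul_eq_mul] at hsum
  rw [← Finset.mul_sum, hs] at hsum
  linarith

lemma quad_eigen {A : Matrix (Fin n) (Fin n) ℝ} (hA : A.IsHermitian) (y : Fin n → ℝ) :
    y ⬝ᵥ A *ᵥ y = ∑ i, hA.eigenvalues i * (∑ v, hA.eigenvectorBasis i v * y v) ^ 2 := by
  have h := hA.eigenvectorBasis.sum_inner_mul_inner (WithLp.toLp 2 y) (WithLp.toLp 2 (A *ᵥ y))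
  have e1 : inner ℝ (WithLp.toLp 2 y) (WithLp.toLp 2 (A *ᵥ y)) = y ⬝ᵥ A *ᵥ y := by
    rw [EuclideanSpace.inner_toLp_toLp, dotProduct_comm]; simp
  rw [← e1, ← h]
  refine Finset.sum_congr rfl fun i _ => ?_
  have e2 : inner ℝ (WithLp.toLp 2 y) (hA.eigenvectorBasis i)
      = ∑ v, hA.eigenvectorBasis i v * y v := by
    simp [PiLp.inner_apply]
  have e3 : inner ℝ (hA.eigenvectorBasis i) (WithLp.toLp 2 (A *ᵥ y))
      = hA.eigenvalues i * ∑ v, hA.eigenvectorBasis i v * y v := by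
    have : inner ℝ (hA.eigenvectorBasis i) (WithLp.toLp 2 (A *ᵥ y))
        = (hA.eigenvectorBasis i : Fin n → ℝ) ⬝ᵥ (A *ᵥ y) := by
      simp [PiLp.inner_apply, dotProduct, mul_comm]
    rw [this, dotProduct_mulVec, ← mulVec_transpose]
    have hT : Aᵀ = A := by simpa using hA.eq
    rw [hT, hA.mulVec_eigenvectorBasis, smul_dotProduct]
    rfl
  rw [e2, e3]; ring

lemma spec_bound {ι : Type*} [Fintype ι] (A : Matrix (Fin n) (Fin n) ℝ) (hA : A.IsHermitian)
    (lam : Fin n → ℝ) (hlam : Antitone lam) (hc : A.charpoly = ∏ i, (X - C (lam i)))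
    (c : ι → Fin n → ℝ) (M : ℝ) (m : ℕ) (hm : 1 ≤ m) (hmn : m ≤ n)
    (h1 : ∀ w : Fin n → ℝ, ∑ ρ, (∑ v, w v * c ρ v) ^ 2 ≤ (∑ v, w v ^ 2) * M)
    (h2 : ∑ v, ∑ ρ, c ρ v ^ 2 = m * M) :
    ∑ ρ, c ρ ⬝ᵥ A *ᵥ c ρ ≤
      (∑ i ∈ Finset.univ.filter (fun i : Fin n => (i : ℕ) < m), lam i) * M := by
  obtain ⟨e, he⟩ := exists_perm_of_prod_eq hA.eigenvalues lam (by rw [← hc, hA.charpoly_eq]; rfl)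
  set γ : Fin n → ℝ := fun i => ∑ ρ, (∑ v, hA.eigenvectorBasis i v * c ρ v) ^ 2 with hγ
  have hq : ∑ ρ, c ρ ⬝ᵥ A *ᵥ c ρ = ∑ i, lam i * γ (e.symm i) := by
    rw [← Equiv.sum_comp e]
    simp_rw [quad_eigen hA, he, Equiv.symm_apply_apply, hγ, Finset.mul_sum]
    rw [Finset.sum_comm]
  rw [hq]
  refine weighted_bound lam (fun i => γ (e.symm i)) hlam M m hm hmn ?_ ?_ ?_
  · intro i; exact Finset.sum_nonneg fun _ _ => sq_nonneg _
  · intro i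
    refine (h1 _).trans_eq ?_
    have := hA.eigenvectorBasis.orthonormal.1 (e.symm i)
    have h3 : ∑ v, (hA.eigenvectorBasis (e.symm i) v) ^ 2 = 1 := by
      rw [← EuclideanSpace.real_norm_sq_eq, this]; norm_num
    rw [h3, one_mul]
  · rw [Equiv.sum_comp e.symm γ, ← h2, Finset.sum_comm, Finset.sum_comm (s := Finset.univ (α := Fin n))]
    refine Finset.sum_congr rfl fun ρ _ => ?_
    have := hA.eigenvectorBasis.sum_sq_inner_right (WithLp.toLp 2 (c ρ))
    rw [EuclideanSpace.real_norm_sq_eq] at this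
    simp only at this
    rw [← this]
    refine Finset.sum_congr rfl fun i _ => ?_
    simp [PiLp.inner_apply, mul_comm]

end helpers2

section helpers3
variable {n : ℕ}

lemma finrank_ker_le {α β δ : Type*} [Fintype α] {_ : Fintype β} {_ : Fintype δ}
    (A : Matrix α β ℝ) (B : Matrix β δ ℝ)
    (h : ∀ z : β → ℝ, A *ᵥ z = 0 → Bᵀ *ᵥ z = 0 → z = 0) :
    Module.finrank ℝ (LinearMap.ker A.mulVecLin) ≤ Module.finrank ℝ (LinearMap.range B.mulVecLin) := by
  have hd : Disjoint (LinearMap.ker A.mulVecLin) (LinearMap.ker Bᵀ.mulVecLin) := by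
    rw [Submodule.disjoint_def]
    intro z h1 h2
    exact h z (LinearMap.mem_ker.1 h1) (LinearMap.mem_ker.1 h2)
  have h1 := Submodule.finrank_add_finrank_le_of_disjoint hd
  have h2 := LinearMap.finrank_range_add_finrank_ker Bᵀ.mulVecLin
  have h3 : Module.finrank ℝ (LinearMap.range Bᵀ.mulVecLin) =
      Module.finrank ℝ (LinearMap.range B.mulVecLin) := by
    classical
    exact Matrix.rank_transpose B
  omega

noncomputable def extF (G : SimpleGraph (Fin n)) [DecidableRel G.Adj] (k : ℕ)
    (z : G.indepFace k → ℝ) (σ : Finset (Fin n)) : ℝ :=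
  if h : σ.card = k ∧ ∀ u ∈ σ, ∀ v ∈ σ, ¬ G.Adj u v then z ⟨σ, h⟩ else 0

lemma extF_coe (G : SimpleGraph (Fin n)) [DecidableRel G.Adj] (k : ℕ)
    (z : G.indepFace k → ℝ) (σ : G.indepFace k) : extF G k z σ.1 = z σ := by
  rw [extF, dif_pos σ.2]

lemma extF_supp (G : SimpleGraph (Fin n)) [DecidableRel G.Adj] (k : ℕ)
    (z : G.indepFace k → ℝ) (σ : Finset (Fin n)) (h : extF G k z σ ≠ 0) :
    σ.card = k ∧ ∀ u ∈ σ, ∀ v ∈ σ, ¬ G.Adj u v := by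
  by_contra h'
  exact h (dif_neg h')

lemma sum_extF (G : SimpleGraph (Fin n)) [DecidableRel G.Adj] (k : ℕ)
    (z : G.indepFace k → ℝ) (f : Finset (Fin n) → ℝ) :
    ∑ σ : G.indepFace k, f σ.1 * z σ = ∑ σ, f σ * extF G k z σ := by
  have : ∀ σ : G.indepFace k, f σ.1 * z σ = (fun s => f s * extF G k z s) σ.1 := fun σ => by
    simp only [extF_coe]
  simp_rw [this]
  rw [← Finset.sum_subtype (Finset.univ.filter (fun σ : Finset (Fin n) =>
    σ.card = k ∧ ∀ u ∈ σ, ∀ v ∈ σ, ¬ G.Adj u v)) (by simp) (fun s => f s * extF G k z s)]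
  refine Finset.sum_subset (Finset.subset_univ _) fun σ _ hσ => ?_
  simp only [Finset.mem_filter, Finset.mem_univ, true_and] at hσ
  rw [extF, dif_neg hσ, mul_zero]

lemma bdry_entry (G : SimpleGraph (Fin n)) [DecidableRel G.Adj] (k : ℕ)
    (σ : G.indepFace k) (τ : G.indepFace (k + 1)) :
    G.indepBoundary k σ τ =
      ∑ v, if v ∈ τ.1 ∧ σ.1 = τ.1.erase v then sgF v τ.1 else 0 := by
  rw [SimpleGraph.indepBoundary, Matrix.of_apply]
  split_ifs with h
  · rw [← Finset.sum_filter]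
    refine Finset.sum_congr ?_ fun _ _ => rfl
    ext v
    simp only [Finset.mem_sdiff, Finset.mem_filter, Finset.mem_univ, true_and]
    refine and_congr_right fun hv => ⟨fun h' => ?_, fun h' => by simp [h']⟩
    refine Finset.eq_of_subset_of_card_le (Finset.subset_erase.2 ⟨h, h'⟩) ?_
    rw [Finset.card_erase_of_mem hv, σ.2.1, τ.2.1]; simp
  · symm
    refine Finset.sum_eq_zero fun v _ => if_neg ?_
    rintro ⟨_, h'⟩
    exact h (h' ▸ Finset.erase_subset _ _)

lemma bdryT_eq (G : SimpleGraph (Fin n)) [DecidableRel G.Adj] (k : ℕ)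
    (z : G.indepFace k → ℝ) (τ : G.indepFace (k + 1)) :
    ((G.indepBoundary k)ᵀ *ᵥ z) τ = ∑ v, creF (extF G k z) v τ.1 := by
  simp only [mulVec, dotProduct, transpose_apply, bdry_entry]
  rw [sum_extF G k z (fun s => ∑ v, if v ∈ τ.1 ∧ s = τ.1.erase v then sgF v τ.1 else 0)]
  simp_rw [Finset.sum_mul]
  rw [Finset.sum_comm]
  refine Finset.sum_congr rfl fun v _ => ?_
  by_cases hv : v ∈ τ.1
  · simp [creF, hv]
  · simp [creF, hv]

lemma bdry_eq (G : SimpleGraph (Fin n)) [DecidableRel G.Adj] (k : ℕ)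
    (z : G.indepFace (k + 1) → ℝ) (σ : G.indepFace k) :
    (G.indepBoundary k *ᵥ z) σ = ∑ v, annF (extF G (k + 1) z) v σ.1 := by
  simp only [mulVec, dotProduct, bdry_entry]
  rw [sum_extF G (k + 1) z (fun s => ∑ v, if v ∈ s ∧ σ.1 = s.erase v then sgF v s else 0)]
  simp_rw [Finset.sum_mul]
  rw [Finset.sum_comm]
  refine Finset.sum_congr rfl fun v _ => ?_
  rw [Finset.sum_eq_single (insert v σ.1)]
  · by_cases hv : v ∈ σ.1
    · have : σ.1 ≠ (insert v σ.1).erase v := fun h => by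
        rw [h] at hv; simp at hv
      simp only [annF, hv, if_true]
      rw [if_neg (by tauto), zero_mul]
    · simp [annF, hv, Finset.erase_insert hv, sgF_insert]
  · intro s _ hs
    rw [if_neg, zero_mul]
    rintro ⟨h1, h2⟩
    exact hs (by rw [h2, Finset.insert_erase h1])
  · simp

lemma ann_zero (G : SimpleGraph (Fin n)) [DecidableRel G.Adj] (k : ℕ)
    (z : G.indepFace (k + 1) → ℝ) (h : G.indepBoundary k *ᵥ z = 0) (ρ : Finset (Fin n)) :
    ∑ v, annF (extF G (k + 1) z) v ρ = 0 := by
  by_cases hρ : ρ.card = k ∧ ∀ u ∈ ρ, ∀ v ∈ ρ, ¬ G.Adj u v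
  · rw [← bdry_eq G k z ⟨ρ, hρ⟩, h]; rfl
  · refine Finset.sum_eq_zero fun v _ => ?_
    unfold annF
    split_ifs with hv
    · rfl
    · by_cases h0 : extF G (k + 1) z (insert v ρ) = 0
      · rw [h0, mul_zero]
      · exfalso
        obtain ⟨h1, h2⟩ := extF_supp G _ z _ h0
        rw [Finset.card_insert_of_notMem hv] at h1
        exact hρ ⟨by omega, fun a ha b hb =>
          h2 a (Finset.mem_insert_of_mem ha) b (Finset.mem_insert_of_mem hb)⟩

lemma cre_zero (G : SimpleGraph (Fin n)) [DecidableRel G.Adj] (k : ℕ)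
    (z : G.indepFace k → ℝ) (h : (G.indepBoundary k)ᵀ *ᵥ z = 0) (τ : Finset (Fin n))
    (hτ : ∀ u ∈ τ, ∀ v ∈ τ, ¬ G.Adj u v) :
    ∑ v, creF (extF G k z) v τ = 0 := by
  by_cases hc : τ.card = k + 1
  · rw [← bdryT_eq G k z ⟨τ, hc, hτ⟩, h]; rfl
  · refine Finset.sum_eq_zero fun v _ => ?_
    unfold creF
    split_ifs with hv
    · by_cases h0 : extF G k z (τ.erase v) = 0
      · rw [h0, mul_zero]
      · exfalso
        obtain ⟨h1, h2⟩ := extF_supp G _ z _ h0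
        have := Finset.card_erase_add_one hv
        omega
    · rfl

end helpers3

/-- Let `G` be a graph on `n` vertices with Laplacian eigenvalues
`λ 0 ≥ λ 1 ≥ ⋯ ≥ λ (n-1) = 0`. If `k` is the minimal number such that the sum of the
`k` largest Laplacian eigenvalues is at least `n`, then `H̃_i(I(G); ℝ) = 0` for all
`i ≤ k - 2`. -/
theorem indep_homology_vanishing {n : ℕ} (G : SimpleGraph (Fin n)) [DecidableRel G.Adj]
    (lam : Fin n → ℝ) (hlam : Antitone lam)
    (hc : (G.lapMatrix ℝ).charpoly = ∏ i, (X - C (lam i)))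
    (k : ℕ)
    (hk : (n : ℝ) ≤ ∑ i ∈ Finset.univ.filter (fun i : Fin n => (i : ℕ) < k), lam i)
    (hmin : ∀ m < k, ∑ i ∈ Finset.univ.filter (fun i : Fin n => (i : ℕ) < m), lam i < n) :
    ∀ i : ℕ, i + 2 ≤ k → G.indepHomologyDim i = 0 := by
  intro i hi
  rw [SimpleGraph.indepHomologyDim, Nat.sub_eq_zero_iff_le]
  refine finrank_ker_le _ _ fun z h1' h2' => ?_
  have h1 : G.indepBoundary i *ᵥ z = 0 := by convert h1'
  have h2 : (G.indepBoundary (i + 1))ᵀ *ᵥ z = 0 := by convert h2'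
  set x := extF G (i + 1) z with hxd
  have hx0 : ∑ ρ, x ρ * x ρ = 0 → z = 0 := by
    intro h
    rw [Finset.sum_eq_zero_iff_of_nonneg (fun _ _ => mul_self_nonneg _)] at h
    funext σ
    have := h σ.1 (Finset.mem_univ _)
    rw [hxd, extF_coe] at this
    simpa using this
  have hxc : ∀ σ, x σ ≠ 0 → σ.card = i + 1 := fun σ h => (extF_supp G _ z σ h).1
  have hxi : ∀ σ, x σ ≠ 0 → ∀ u ∈ σ, ∀ v ∈ σ, ¬ G.Adj u v := fun σ h => (extF_supp G _ z σ h).2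
  by_cases hn : n < i + 1
  · apply hx0
    refine Finset.sum_eq_zero fun σ _ => ?_
    by_cases h : x σ = 0
    · simp [h]
    · have := hxc σ h
      have := Finset.card_le_univ σ
      simp at this
      omega
  apply hx0
  have hM : 0 ≤ ∑ ρ, x ρ * x ρ := Finset.sum_nonneg fun _ _ => mul_self_nonneg _
  have hS := hmin (i + 1) (by omega)
  have car := car_smear x (fun _ => 1)
  simp only [one_mul, one_pow, Finset.sum_const, Finset.card_univ, Fintype.card_fin, nsmul_eq_mul,
    mul_one] at car
  have hann : ∑ ρ, (∑ v, annF x v ρ) ^ 2 = 0 :=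
    Finset.sum_eq_zero fun ρ _ => by rw [ann_zero G i z h1 ρ]; norm_num
  have hup := up_bound G x hxi (fun τ hτ => cre_zero G (i + 1) z h2 τ hτ)
  have hsp := spec_bound (G.lapMatrix ℝ) (G.isHermitian_lapMatrix ℝ) lam hlam hc
    (fun ρ v => annF x v ρ) (∑ ρ, x ρ * x ρ) (i + 1) (by omega) (by omega)
    (fun w => by
      rw [← car_smear x w]
      exact le_add_of_nonneg_right (Finset.sum_nonneg fun _ _ => sq_nonneg _))
    (number_op x (i + 1) hxc)
  have hL : ∀ ρ, (fun v => annF x v ρ) ⬝ᵥ G.lapMatrix ℝ *ᵥ (fun v => annF x v ρ) =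
      (∑ u, ∑ v, if G.Adj u v then (annF x u ρ - annF x v ρ) ^ 2 else 0) / 2 := by
    intro ρ
    rw [← Matrix.toLinearMap₂'_apply', G.lapMatrix_toLinearMap₂' ℝ]
  simp_rw [hL] at hsp
  rw [hann, zero_add] at car
  nlinarith
end

section
/- Let $G=(V,E)$ be a finite graph with Laplacian matrix $L(G)=D-A$ and let $1\le k\le|V|$. Then the sum of the $k$ largest eigenvalues of $L(G)$ is at most $2\cdot\max_{\sigma}|\{e\in E: e\cap\sigma\neq\emptyset\}|$, where the maximum is over all $k$-element subsets $\sigma\subseteq V$. -/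
open Matrix Polynomial

namespace LapAux

/-- Symmetrised Cauchy–Binet. -/
lemma det_weight {n k : ℕ} (U : Matrix (Fin n) (Fin k) ℝ) (d : Fin n → ℝ) :
    (k.factorial : ℝ) * (Uᵀ * Matrix.diagonal d * U).det =
      ∑ f : Fin k → Fin n, (U.submatrix f id).det ^ 2 * ∏ i, d (f i) := by
  have h1 : (Uᵀ * Matrix.diagonal d * U).det =
      ∑ f : Fin k → Fin n, (∏ i, d (f i)) * ((∏ i, U (f i) i) * (U.submatrix f id).det) := by
    have hrow : (Uᵀ * Matrix.diagonal d * U) =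
        fun i => ∑ x : Fin n, (d x * U x i) • (U x) := by
      ext i j
      rw [Finset.sum_apply, Matrix.mul_apply]
      refine Finset.sum_congr rfl fun x _ => ?_
      simp [Matrix.mul_diagonal, mul_comm]
    rw [hrow]
    have := (Matrix.detRowAlternating (n := Fin k) (R := ℝ)).toMultilinearMap.map_sum
      (fun (i : Fin k) (x : Fin n) => (d x * U x i) • (U x))
    refine this.trans ?_
    refine Finset.sum_congr rfl fun f _ => ?_
    rw [MultilinearMap.map_smul_univ, Finset.prod_mul_distrib, smul_eq_mul, mul_assoc]
    rfl
  have h2 : ∀ τ : Equiv.Perm (Fin k), (Uᵀ * Matrix.diagonal d * U).det =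
      ∑ f : Fin k → Fin n, (∏ i, d (f i)) *
        ((Equiv.Perm.sign τ : ℝ) * (∏ i, U (f (τ i)) i) * (U.submatrix f id).det) := by
    intro τ
    rw [h1, ← Equiv.sum_comp (Equiv.arrowCongr τ.symm (Equiv.refl (Fin n)))]
    refine Finset.sum_congr rfl fun f _ => ?_
    have e1 : ∏ i, d (f (τ i)) = ∏ i, d (f i) := Equiv.prod_comp τ (fun i => d (f i))
    have e2 : (U.submatrix (f ∘ τ) id).det =
        (Equiv.Perm.sign τ : ℝ) * (U.submatrix f id).det := by
      have := Matrix.det_permute τ (U.submatrix f id)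
      simpa [Matrix.submatrix_submatrix] using this
    have e3 : (Equiv.arrowCongr τ.symm (Equiv.refl (Fin n))) f = f ∘ τ := by
      ext i; simp [Equiv.arrowCongr]
    rw [e3, e2]
    simp only [Function.comp]
    rw [e1]; ring
  have h3 : ∑ τ : Equiv.Perm (Fin k), (Uᵀ * Matrix.diagonal d * U).det =
      (k.factorial : ℝ) * (Uᵀ * Matrix.diagonal d * U).det := by
    simp [Finset.card_univ, Fintype.card_perm]
  rw [← h3, Finset.sum_congr rfl (fun τ _ => h2 τ), Finset.sum_comm]
  refine Finset.sum_congr rfl fun f _ => ?_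
  rw [← Finset.mul_sum, ← Finset.sum_mul, mul_comm]
  have : (U.submatrix f id).det =
      ∑ τ : Equiv.Perm (Fin k), (Equiv.Perm.sign τ : ℝ) * ∏ i, U (f (τ i)) i := by
    rw [Matrix.det_apply']; rfl
  rw [← this]; ring

lemma det_avoid {n k m : ℕ} (U : Matrix (Fin n) (Fin k) ℝ) (hU : Uᵀ * U = 1)
    (v : Fin m → Fin n) (hv : Function.Injective v) :
    (Uᵀ * Matrix.diagonal (fun x => if x ∈ Set.range v then (0:ℝ) else 1) * U).det =
      (1 - U.submatrix v id * (U.submatrix v id)ᵀ).det := by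
  classical
  have : Uᵀ * Matrix.diagonal (fun x => if x ∈ Set.range v then (0:ℝ) else 1) * U =
      1 - (U.submatrix v id)ᵀ * U.submatrix v id := by
    rw [← hU]
    ext i j
    rw [Matrix.sub_apply, Matrix.mul_apply, Matrix.mul_apply, Matrix.mul_apply, eq_sub_iff_add_eq]
    have : ∑ x, (U.submatrix v id)ᵀ i x * (U.submatrix v id) x j =
        ∑ x, if x ∈ Set.range v then U x i * U x j else 0 := by
      rw [← Finset.sum_filter]
      have : (Finset.univ.filter fun x => x ∈ Set.range v) = Finset.univ.map ⟨v, hv⟩ := by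
        ext x; simp
      rw [this, Finset.sum_map]; rfl
    rw [this, ← Finset.sum_add_distrib]
    refine Finset.sum_congr rfl fun x _ => ?_
    rw [Matrix.mul_diagonal]
    split_ifs <;> simp
  rw [this, Matrix.det_one_sub_mul_comm]

lemma det_nonneg {n k : ℕ} (U : Matrix (Fin n) (Fin k) ℝ) (d : Fin n → ℝ) (hd : ∀ x, 0 ≤ d x) :
    0 ≤ (Uᵀ * Matrix.diagonal d * U).det := by
  have h := det_weight U d
  have h0 : 0 ≤ (k.factorial : ℝ) * (Uᵀ * Matrix.diagonal d * U).det := by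
    rw [h]
    exact Finset.sum_nonneg fun f _ =>
      mul_nonneg (sq_nonneg _) (Finset.prod_nonneg fun i _ => hd _)
  have : (0:ℝ) < k.factorial := by exact_mod_cast k.factorial_pos
  exact nonneg_of_mul_nonneg_right h0 this

lemma key_ineq (a b c : ℝ) (ha : 0 ≤ a) (hb : 0 ≤ b) (ha1 : a ≤ 1) (hb1 : b ≤ 1)
    (h1 : c ^ 2 ≤ a * b) (h2 : c ^ 2 ≤ (1 - a) * (1 - b)) :
    a + b - 2 * c ≤ 2 * (1 - ((1 - a) * (1 - b) - c ^ 2)) := by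
  have core : ∀ a b : ℝ, 0 ≤ a → 0 ≤ b → c ^ 2 ≤ a * b → a + b ≤ 1 →
      0 ≤ a + b - 2 * a * b + 2 * c ^ 2 + 2 * c := by
    intro a b ha hb h1 hs
    have hs2 : -c ≤ (a + b) / 2 := by
      nlinarith [sq_nonneg (a - b)]
    have hs3 : c ≤ (a + b) / 2 := by
      nlinarith [sq_nonneg (a - b)]
    have : 0 ≤ (a + b + 2 * c) * (2 - (a + b - 2 * c)) := by
      apply mul_nonneg <;> linarith
    nlinarith [sq_nonneg (a - b)]
  rcases le_total (a + b) 1 with h | h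
  · have := core a b ha hb h1 h
    nlinarith
  · have := core (1 - a) (1 - b) (by linarith) (by linarith) h2 (by linarith)
    nlinarith

lemma two_touch {n : ℕ} (G : SimpleGraph (Fin n)) [DecidableRel G.Adj] (σ : Finset (Fin n)) :
    2 * ((G.edgeFinset.filter fun e => ∃ v ∈ σ, v ∈ e).card : ℝ) =
      ∑ i, ∑ j, if G.Adj i j then (if i ∈ σ ∨ j ∈ σ then (1:ℝ) else 0) else 0 := by
  classical
  let H : SimpleGraph (Fin n) :=
    { Adj := fun i j => G.Adj i j ∧ (i ∈ σ ∨ j ∈ σ)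
      symm := ⟨fun i j h => ⟨h.1.symm, h.2.symm⟩⟩
      loopless := ⟨fun i h => G.loopless.irrefl i h.1⟩ }
  have hE : H.edgeFinset = G.edgeFinset.filter fun e => ∃ v ∈ σ, v ∈ e := by
    ext e
    induction e using Sym2.ind with
    | _ x y =>
      simp only [SimpleGraph.mem_edgeFinset, SimpleGraph.mem_edgeSet, Finset.mem_filter,
        Sym2.mem_iff, H]
      constructor
      · rintro ⟨h, h' | h'⟩
        · exact ⟨h, x, h', Or.inl rfl⟩
        · exact ⟨h, y, h', Or.inr rfl⟩
      · rintro ⟨h, v, hv, rfl | rfl⟩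
        · exact ⟨h, Or.inl hv⟩
        · exact ⟨h, Or.inr hv⟩
  have hs := H.sum_degrees_eq_twice_card_edges
  rw [hE] at hs
  have hs' : (2 * ((G.edgeFinset.filter fun e => ∃ v ∈ σ, v ∈ e).card : ℝ)) =
      ∑ v, (H.degree v : ℝ) := by
    exact_mod_cast hs.symm
  rw [hs']
  refine Finset.sum_congr rfl fun i _ => ?_
  rw [← SimpleGraph.card_neighborFinset_eq_degree, SimpleGraph.neighborFinset_eq_filter,
    Finset.card_filter]
  push_cast
  refine Finset.sum_congr rfl fun j _ => ?_
  simp only [H]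
  split_ifs <;> simp_all

lemma frame {n : ℕ} (G : SimpleGraph (Fin n)) [DecidableRel G.Adj]
    (k : ℕ) (hkn : k ≤ n) (μ : Fin n → ℝ)
    (hc : (G.lapMatrix ℝ).charpoly = ∏ i, (X - C (μ i))) :
    ∃ U : Matrix (Fin n) (Fin k) ℝ, Uᵀ * U = 1 ∧
      ∑ i ∈ Finset.univ.filter (fun i : Fin n => (i : ℕ) < k), μ i =
        ∑ j, (fun x => U x j) ⬝ᵥ (G.lapMatrix ℝ *ᵥ (fun x => U x j)) := by
  classical
  have hL : (G.lapMatrix ℝ).IsHermitian := by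
    have := G.isSymm_lapMatrix (R := ℝ)
    rwa [Matrix.IsHermitian, Matrix.conjTranspose_eq_transpose_of_trivial]
  have h1 : (Finset.univ.val.map μ) = Finset.univ.val.map hL.eigenvalues := by
    have h2 := hL.roots_charpoly_eq_eigenvalues
    have h3 : ∏ i, (X - C (μ i)) = ((Finset.univ.val.map μ).map fun a => X - C a).prod := by
      rw [Multiset.map_map]; rfl
    rw [hc, h3, Polynomial.roots_multiset_prod_X_sub_C] at h2
    simpa using h2
  obtain ⟨π, hπ⟩ : ∃ π : Equiv.Perm (Fin n), ∀ i, μ i = hL.eigenvalues (π i) := by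
    have hcard : ∀ a : ℝ, Nonempty ({i // μ i = a} ≃ {i // hL.eigenvalues i = a}) := by
      intro a
      refine ⟨Fintype.equivOfCardEq ?_⟩
      have h2 := congrArg (Multiset.count a) h1
      rw [Multiset.count_map, Multiset.count_map] at h2
      rw [Fintype.card_subtype, Fintype.card_subtype]
      simpa only [Finset.card_def, Finset.filter_val, eq_comm] using h2
    exact ⟨Equiv.ofFiberEquiv fun a => (hcard a).some,
      fun i => (Equiv.ofFiberEquiv_map (fun a => (hcard a).some) i).symm⟩
  let u : Fin k → EuclideanSpace ℝ (Fin n) := fun j => hL.eigenvectorBasis (π (Fin.castLE hkn j))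
  have hu : ∀ i j, (u i).ofLp ⬝ᵥ (u j).ofLp = if i = j then 1 else 0 := by
    intro i j
    have := (orthonormal_iff_ite.mp hL.eigenvectorBasis.orthonormal)
      (π (Fin.castLE hkn i)) (π (Fin.castLE hkn j))
    simp only [EmbeddingLike.apply_eq_iff_eq, (Fin.castLE_injective hkn).eq_iff] at this
    rw [← this, EuclideanSpace.inner_eq_star_dotProduct, dotProduct_comm]
    simp [u]
  refine ⟨fun x j => (u j).ofLp x, ?_, ?_⟩
  · ext i j
    rw [Matrix.one_apply, ← hu i j]; rfl
  · have : ∀ j, (u j).ofLp ⬝ᵥ (G.lapMatrix ℝ *ᵥ (u j).ofLp) = μ (Fin.castLE hkn j) := by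
      intro j
      have := hL.mulVec_eigenvectorBasis (π (Fin.castLE hkn j))
      simp only [u]
      rw [this, dotProduct_smul, hu j j, hπ]
      simp
    refine Eq.trans ?_ (Finset.sum_congr rfl fun j _ => (this j).symm)
    have e : (Finset.univ.filter (fun i : Fin n => (i : ℕ) < k)) =
        Finset.univ.map (Fin.castLEEmb hkn) := by
      ext x
      simp only [Finset.mem_filter, Finset.mem_univ, true_and, Finset.mem_map]
      exact ⟨fun h => ⟨⟨x, h⟩, rfl⟩, by rintro ⟨y, rfl⟩; exact y.2⟩
    rw [e, Finset.sum_map]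
    rfl

end LapAux

/-- Let `G` be a graph on `n` vertices with Laplacian eigenvalues
`μ 0 ≥ μ 1 ≥ ⋯ ≥ μ (n-1)` (with multiplicity) and `1 ≤ k ≤ n`. Then the sum of the `k`
largest Laplacian eigenvalues is at most
`2 · max_{σ ⊆ V, |σ| = k} #{e ∈ E : e ∩ σ ≠ ∅}`. -/
theorem lap_topk_sum_le {n : ℕ} (G : SimpleGraph (Fin n)) [DecidableRel G.Adj]
    (k : ℕ) (hk1 : 1 ≤ k) (hkn : k ≤ n)
    (μ : Fin n → ℝ) (hμ : Antitone μ)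
    (hc : (G.lapMatrix ℝ).charpoly = ∏ i, (X - C (μ i))) :
    ∑ i ∈ Finset.univ.filter (fun i : Fin n => (i : ℕ) < k), μ i ≤
      2 * (((Finset.univ : Finset (Fin n)).powersetCard k).sup'
        (Finset.powersetCard_nonempty.mpr (by simpa using hkn))
        fun σ => ((G.edgeFinset.filter fun e => ∃ v ∈ σ, v ∈ e).card : ℝ)) := by
  classical
  obtain ⟨U, hU, hsum⟩ := LapAux.frame G k hkn μ hc
  rw [hsum]
  set M := (((Finset.univ : Finset (Fin n)).powersetCard k).sup'
        (Finset.powersetCard_nonempty.mpr (by simpa using hkn))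
        fun σ => ((G.edgeFinset.filter fun e => ∃ v ∈ σ, v ∈ e).card : ℝ)) with hM
  have hfac : (0:ℝ) < k.factorial := by exact_mod_cast k.factorial_pos
  let P : Fin n → Fin n → ℝ := fun x y => ∑ j, U x j * U y j
  have hquad : ∑ j, (fun x => U x j) ⬝ᵥ (G.lapMatrix ℝ *ᵥ (fun x => U x j)) =
      (∑ x, ∑ y, if G.Adj x y then (P x x + P y y - 2 * P x y) else 0) / 2 := by
    have : ∀ j, (fun x => U x j) ⬝ᵥ (G.lapMatrix ℝ *ᵥ (fun x => U x j)) =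
        (∑ x, ∑ y, if G.Adj x y then (U x j - U y j) ^ 2 else 0) / 2 := by
      intro j
      rw [← SimpleGraph.lapMatrix_toLinearMap₂', Matrix.toLinearMap₂'_apply']
    rw [Finset.sum_congr rfl fun j _ => this j, ← Finset.sum_div, Finset.sum_comm]
    congr 1
    refine Finset.sum_congr rfl fun x _ => ?_
    rw [Finset.sum_comm]
    refine Finset.sum_congr rfl fun y _ => ?_
    split_ifs
    · simp only [P, Finset.mul_sum]
      rw [← Finset.sum_add_distrib, ← Finset.sum_sub_distrib]
      exact Finset.sum_congr rfl fun j _ => by ring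
    · simp
  have hnn : ∀ x, 0 ≤ P x x := fun x => Finset.sum_nonneg fun j _ => mul_self_nonneg _
  have hCS : ∀ x y, P x y ^ 2 ≤ P x x * P y y := by
    intro x y
    have := Finset.sum_mul_sq_le_sq_mul_sq Finset.univ (fun j => U x j) (fun j => U y j)
    simpa [P, sq] using this
  have hle1 : ∀ x, P x x ≤ 1 := by
    intro x
    have h := LapAux.det_avoid U hU (fun _ : Fin 1 => x) (fun a b _ => Subsingleton.elim a b)
    have h0 := LapAux.det_nonneg U
      (fun z => if z ∈ Set.range (fun _ : Fin 1 => x) then (0:ℝ) else 1)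
      (fun z => by split_ifs <;> norm_num)
    rw [h, Matrix.det_fin_one] at h0
    simp only [Matrix.sub_apply, Matrix.one_apply_eq, Matrix.mul_apply, Matrix.transpose_apply,
      Matrix.submatrix_apply, id] at h0
    simp only [P]; linarith
  have h2 : ∀ x y, x ≠ y →
      (Uᵀ * Matrix.diagonal (fun z => if z ∈ Set.range ![x, y] then (0:ℝ) else 1) * U).det =
      (1 - P x x) * (1 - P y y) - P x y ^ 2 := by
    intro x y hxy
    have hinj : Function.Injective ![x, y] := by
      intro a b; fin_cases a <;> fin_cases b <;> simp [hxy, hxy.symm]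
    rw [LapAux.det_avoid U hU ![x, y] hinj, Matrix.det_fin_two]
    have : P y x = P x y := Finset.sum_congr rfl fun j _ => mul_comm _ _
    simp only [Matrix.sub_apply, Matrix.one_apply, Matrix.mul_apply, Matrix.transpose_apply,
      Matrix.submatrix_apply, id]
    simp only [P] at this ⊢
    simp [this]
    ring
  have h2n : ∀ x y, x ≠ y → 0 ≤ (1 - P x x) * (1 - P y y) - P x y ^ 2 := by
    intro x y hxy
    rw [← h2 x y hxy]
    exact LapAux.det_nonneg U _ (fun z => by split_ifs <;> norm_num)
  let w : (Fin k → Fin n) → ℝ := fun f => (U.submatrix f id).det ^ 2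
  have hw1 : ∑ f, w f = k.factorial := by
    have := LapAux.det_weight U (fun _ => 1)
    simpa [hU] using this.symm
  have hw2 : ∀ x y, x ≠ y →
      ∑ f, w f * (if x ∈ Finset.univ.image f ∨ y ∈ Finset.univ.image f then (1:ℝ) else 0) =
      k.factorial * (1 - ((1 - P x x) * (1 - P y y) - P x y ^ 2)) := by
    intro x y hxy
    rw [mul_sub, mul_one, ← h2 x y hxy, LapAux.det_weight, ← hw1, ← Finset.sum_sub_distrib]
    refine Finset.sum_congr rfl fun f _ => ?_
    have : ∏ i, (if f i ∈ Set.range ![x, y] then (0:ℝ) else 1) =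
        1 - (if x ∈ Finset.univ.image f ∨ y ∈ Finset.univ.image f then (1:ℝ) else 0) := by
      split_ifs with h
      · rw [sub_self]
        rcases h with h | h
        · obtain ⟨i, _, hi⟩ := Finset.mem_image.mp h
          exact Finset.prod_eq_zero (Finset.mem_univ i) (if_pos ⟨0, by simp [hi]⟩)
        · obtain ⟨i, _, hi⟩ := Finset.mem_image.mp h
          exact Finset.prod_eq_zero (Finset.mem_univ i) (if_pos ⟨1, by simp [hi]⟩)
      · rw [sub_zero]
        refine Finset.prod_eq_one fun i _ => if_neg ?_
        rintro ⟨a, ha⟩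
        apply h
        fin_cases a
        · exact Or.inl (Finset.mem_image.mpr ⟨i, Finset.mem_univ _, by simpa using ha.symm⟩)
        · exact Or.inr (Finset.mem_image.mpr ⟨i, Finset.mem_univ _, by simpa using ha.symm⟩)
    rw [this]; simp only [w]; ring
  rw [hquad]
  have step1 : (∑ x, ∑ y, if G.Adj x y then (P x x + P y y - 2 * P x y) else 0) / 2 ≤
      ∑ x, ∑ y, if G.Adj x y then (1 - ((1 - P x x) * (1 - P y y) - P x y ^ 2)) else 0 := by
    rw [div_le_iff₀ (by norm_num), Finset.sum_mul]
    refine Finset.sum_le_sum fun x _ => ?_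
    rw [Finset.sum_mul]
    refine Finset.sum_le_sum fun y _ => ?_
    split_ifs with h
    · have := LapAux.key_ineq (P x x) (P y y) (P x y) (hnn x) (hnn y) (hle1 x) (hle1 y)
        (hCS x y) (by linarith [h2n x y h.ne])
      linarith
    · simp
  refine step1.trans ?_
  refine le_of_mul_le_mul_left ?_ hfac
  have step2 : (k.factorial : ℝ) *
      (∑ x, ∑ y, if G.Adj x y then (1 - ((1 - P x x) * (1 - P y y) - P x y ^ 2)) else 0) =
      ∑ f, w f * (2 * ((G.edgeFinset.filter fun e =>
        ∃ v ∈ Finset.univ.image f, v ∈ e).card : ℝ)) := by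
    simp only [LapAux.two_touch, Finset.mul_sum]
    rw [Finset.sum_comm]
    refine Eq.trans ?_ (Finset.sum_comm)
    rw [Finset.sum_comm]
    refine Finset.sum_congr rfl fun x _ => ?_
    rw [Finset.sum_comm]
    refine Finset.sum_congr rfl fun y _ => ?_
    split_ifs with h
    · rw [← hw2 x y h.ne]
    · simp
  rw [step2, ← hw1, Finset.sum_mul]
  refine Finset.sum_le_sum fun f _ => ?_
  by_cases hf : Function.Injective f
  · refine mul_le_mul_of_nonneg_left ?_ (sq_nonneg _)
    refine mul_le_mul_of_nonneg_left ?_ (by norm_num)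
    refine Finset.le_sup' (fun σ : Finset (Fin n) =>
      ((G.edgeFinset.filter fun e => ∃ v ∈ σ, v ∈ e).card : ℝ)) ?_
    rw [Finset.mem_powersetCard]
    exact ⟨Finset.subset_univ _, by rw [Finset.card_image_of_injective _ hf]; simp⟩
  · have : w f = 0 := by
      simp only [Function.Injective, not_forall] at hf
      obtain ⟨a, b, hab, hne⟩ := hf
      simp only [w]
      rw [Matrix.det_zero_of_row_eq hne (by ext j; simp [hab])]
      simp
    rw [this]; simp
end

section
/- Let $G=(V,E)$ be a finite graph with adjacency matrix $A(G)$ and let $1\le k\le|V|$. Then the sum of the $k$ largest eigenvalues of $A(G)$ is at most $\max_{\sigma}|\{e\in E:|e\cap\sigma|=1\}|$, where the maximum is over all $k$-element subsets $\sigma\subseteq V$, i.e., the maximum number of edges in an edge cut $(\sigma, V\setminus\sigma)$ with $|\sigma|=k$. -/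
open Matrix Polynomial

theorem aux_equiv {n : ℕ} (f g : Fin n → ℝ)
    (h : Finset.univ.val.map f = Finset.univ.val.map g) :
    ∃ e : Fin n ≃ Fin n, ∀ i, f i = g (e i) := by
  classical
  have hcard : ∀ x : ℝ, Fintype.card {i // f i = x} = Fintype.card {i // g i = x} := by
    intro x
    have h1 := congrArg (Multiset.count x) h
    rw [Multiset.count_map, Multiset.count_map] at h1
    rw [Fintype.card_subtype, Fintype.card_subtype]
    simp only [Finset.card_def, Finset.filter_val]
    simpa only [eq_comm] using h1
  let F : ∀ x : ℝ, {i // f i = x} ≃ {i // g i = x} := fun x => Fintype.equivOfCardEq (hcard x)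
  refine ⟨(Equiv.sigmaFiberEquiv f).symm.trans
    ((Equiv.sigmaCongrRight F).trans (Equiv.sigmaFiberEquiv g)), fun i => ?_⟩
  have := (F (f i) ⟨i, rfl⟩).2
  simpa [Equiv.sigmaFiberEquiv] using this.symm

theorem aux_sum_det {k : ℕ} (M : Matrix (Fin k) (Fin k) ℝ) (d : Fin k → ℝ) :
    ∑ r, (M.updateRow r (fun i => d i * M r i)).det = (∑ i, d i) * M.det := by
  have h1 : ∀ r, (M.updateRow r (fun i => d i * M r i)).det
      = (M * diagonal d * M.adjugate) r r := by
    intro r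
    rw [← cramer_transpose_apply, cramer_eq_adjugate_mulVec, ← adjugate_transpose,
      Matrix.mul_apply, mulVec, dotProduct]
    refine Finset.sum_congr rfl fun i _ => ?_
    rw [mul_diagonal, transpose_apply]
    ring
  have h2 : ∑ r, (M.updateRow r (fun i => d i * M r i)).det
      = (M * diagonal d * M.adjugate).trace := Finset.sum_congr rfl fun r _ => h1 r
  rw [h2, Matrix.trace_mul_comm, ← Matrix.mul_assoc, adjugate_mul, Matrix.smul_mul,
    Matrix.one_mul, trace_smul, trace_diagonal, smul_eq_mul, mul_comm]

theorem aux_exists_minor {n k : ℕ} (V : Matrix (Fin n) (Fin k) ℝ) (h : Vᵀ * V = 1) :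
    ∃ f : Fin k → Fin n, (V.submatrix f id).det ≠ 0 := by
  by_contra! hf
  have h1 : (Vᵀ * V).det = 0 := by
    have h2 : (Vᵀ * V) = fun i => ∑ u, V u i • V u := by
      ext i j
      simp [Matrix.mul_apply]
    rw [h2]
    have h3 := (detRowAlternating (n := Fin k) (R := ℝ)).toMultilinearMap.map_sum
      (fun (i : Fin k) (u : Fin n) => V u i • V u)
    refine Eq.trans h3 (Finset.sum_eq_zero fun f _ => ?_)
    have h4 := (detRowAlternating (n := Fin k) (R := ℝ)).toMultilinearMap.map_smul_univ
      (fun i => V (f i) i) (fun i => V (f i))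
    refine Eq.trans h4 ?_
    have h5 := hf f
    have h6 : (detRowAlternating (n := Fin k) (R := ℝ)).toMultilinearMap (fun i => V (f i)) = 0 :=
      h5
    rw [h6, smul_zero]
  rw [h, det_one] at h1
  exact one_ne_zero h1

theorem aux_expand {n k : ℕ} (A : Matrix (Fin n) (Fin n) ℝ) (V : Matrix (Fin n) (Fin k) ℝ)
    (d : Fin k → ℝ) (hAV : ∀ u i, (A * V) u i = d i * V u i) (f : Fin k → Fin n) :
    (∑ i, d i) * (V.submatrix f id).det
      = ∑ r, ∑ u, A (f r) u * (V.submatrix (Function.update f r u) id).det := by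
  rw [← aux_sum_det]
  refine Finset.sum_congr rfl fun r _ => ?_
  have h1 : (fun i => d i * (V.submatrix f id) r i) = ∑ u, A (f r) u • V u := by
    ext i
    simp [← hAV, Matrix.mul_apply]
  rw [h1]
  have h3 := (detRowAlternating (n := Fin k) (R := ℝ)).toMultilinearMap.map_update_sum
    Finset.univ r (fun u => A (f r) u • V u) (V.submatrix f id)
  refine Eq.trans h3 (Finset.sum_congr rfl fun u _ => ?_)
  refine Eq.trans (det_updateRow_smul (V.submatrix f id) r (A (f r) u) (V u)) ?_
  congr 2
  ext a b
  by_cases hab : a = r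
  · subst hab; simp
  · simp [hab, updateRow_ne]

theorem aux_main {n k : ℕ} (G : SimpleGraph (Fin n)) [DecidableRel G.Adj]
    (V : Matrix (Fin n) (Fin k) ℝ) (d : Fin k → ℝ) (hV : Vᵀ * V = 1)
    (hAV : ∀ u i, (G.adjMatrix ℝ * V) u i = d i * V u i) :
    ∃ σ : Finset (Fin n), σ.card = k ∧ ∑ i, d i ≤ ((G.edgeFinset.filter fun e =>
          ∃ u v : Fin n, e = s(u, v) ∧ u ∈ σ ∧ v ∉ σ).card : ℝ) := by
  classical
  obtain ⟨f₀, hf₀⟩ := aux_exists_minor V hV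
  have : Nonempty (Fin k → Fin n) := ⟨f₀⟩
  obtain ⟨f, hf⟩ := Finite.exists_max (fun f : Fin k → Fin n => |(V.submatrix f id).det|)
  have hpos : 0 < |(V.submatrix f id).det| := lt_of_lt_of_le (abs_pos.mpr hf₀) (hf f₀)
  have hzero : ∀ g : Fin k → Fin n, ∀ a b, a ≠ b → g a = g b → (V.submatrix g id).det = 0 := by
    intro g a b hab hg
    refine det_zero_of_row_eq hab ?_
    ext i
    simp [hg]
  have hinj : Function.Injective f := by
    intro a b hab
    by_contra hne
    exact (abs_pos.mp hpos) (hzero f a b hne hab)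
  refine ⟨Finset.univ.image f, by simp [Finset.card_image_of_injective _ hinj], ?_⟩
  set σ := Finset.univ.image f with hσ
  let T : Finset (Fin k × Fin n) := Finset.univ.filter fun p => G.Adj (f p.1) p.2 ∧ p.2 ∉ σ
  have hT : (T.card : ℝ) ≤ ((G.edgeFinset.filter fun e =>
          ∃ u v : Fin n, e = s(u, v) ∧ u ∈ σ ∧ v ∉ σ).card : ℝ) := by
    norm_cast
    refine Finset.card_le_card_of_injOn (fun p => s(f p.1, p.2)) ?_ ?_
    · intro p hp
      have hp' : G.Adj (f p.1) p.2 ∧ p.2 ∉ σ := by simpa [T] using hp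
      simp only [Finset.coe_filter, Set.mem_setOf_eq, SimpleGraph.mem_edgeFinset,
        SimpleGraph.mem_edgeSet]
      exact ⟨hp'.1, f p.1, p.2, rfl, by simp [hσ], hp'.2⟩
    · rintro ⟨a, u⟩ hp ⟨b, v⟩ hq h
      have hp' : G.Adj (f a) u ∧ u ∉ σ := by simpa [T] using hp
      have hq' : G.Adj (f b) v ∧ v ∉ σ := by simpa [T] using hq
      simp only [Sym2.eq_iff] at h
      rcases h with ⟨h1, h2⟩ | ⟨h1, h2⟩
      · rw [hinj h1, h2]
      · exact absurd (by rw [← h1]; simp [hσ]) hq'.2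
  refine le_trans ?_ hT
  have hexp := aux_expand (G.adjMatrix ℝ) V d hAV f
  have hterm : ∀ r u, |G.adjMatrix ℝ (f r) u * (V.submatrix (Function.update f r u) id).det|
      ≤ if G.Adj (f r) u ∧ u ∉ σ then |(V.submatrix f id).det| else 0 := by
    intro r u
    by_cases hadj : G.Adj (f r) u
    · by_cases hu : u ∈ σ
      · obtain ⟨b, -, hb⟩ := Finset.mem_image.mp hu
        have hbr : b ≠ r := by
          rintro rfl
          exact G.ne_of_adj hadj hb
        rw [hzero (Function.update f r u) b r hbr (by simp [hbr, hb])]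
        simp [hu]
      · simpa [hadj, hu] using hf (Function.update f r u)
    · simp [hadj]
  have hbound : (∑ i, d i) * |(V.submatrix f id).det| ≤ T.card * |(V.submatrix f id).det| := by
    calc (∑ i, d i) * |(V.submatrix f id).det|
        ≤ |∑ i, d i| * |(V.submatrix f id).det| :=
          mul_le_mul_of_nonneg_right (le_abs_self _) hpos.le
      _ = |∑ r, ∑ u, G.adjMatrix ℝ (f r) u *
            (V.submatrix (Function.update f r u) id).det| := by rw [← abs_mul, hexp]
      _ ≤ ∑ r, ∑ u, |G.adjMatrix ℝ (f r) u *
            (V.submatrix (Function.update f r u) id).det| :=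
          (Finset.abs_sum_le_sum_abs _ _).trans
            (Finset.sum_le_sum fun r _ => Finset.abs_sum_le_sum_abs _ _)
      _ ≤ ∑ r, ∑ u, if G.Adj (f r) u ∧ u ∉ σ then |(V.submatrix f id).det| else 0 :=
          Finset.sum_le_sum fun r _ => Finset.sum_le_sum fun u _ => hterm r u
      _ = T.card * |(V.submatrix f id).det| := by
          rw [← Fintype.sum_prod_type' (f := fun r u =>
            if G.Adj (f r) u ∧ u ∉ σ then |(V.submatrix f id).det| else 0),
            ← Finset.sum_filter, Finset.sum_const, nsmul_eq_mul]
  exact le_of_mul_le_mul_right hbound hpos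

/-- Let `G` be a graph on `n` vertices with adjacency eigenvalues
`μ 0 ≥ μ 1 ≥ ⋯ ≥ μ (n-1)` (with multiplicity) and `1 ≤ k ≤ n`. Then the sum of the `k`
largest adjacency eigenvalues is at most
`max_{σ ⊆ V, |σ| = k} #{e ∈ E : |e ∩ σ| = 1}`, the maximum number of edges in an edge cut
`(σ, V \ σ)` with `|σ| = k`. -/
theorem adj_topk_sum_le {n : ℕ} (G : SimpleGraph (Fin n)) [DecidableRel G.Adj]
    (k : ℕ) (hk1 : 1 ≤ k) (hkn : k ≤ n)
    (μ : Fin n → ℝ) (hμ : Antitone μ)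
    (hc : (G.adjMatrix ℝ).charpoly = ∏ i, (X - C (μ i))) :
    ∑ i ∈ Finset.univ.filter (fun i : Fin n => (i : ℕ) < k), μ i ≤
      ((Finset.univ : Finset (Fin n)).powersetCard k).sup'
        (Finset.powersetCard_nonempty.mpr (by simpa using hkn))
        fun σ => ((G.edgeFinset.filter fun e =>
          ∃ u v : Fin n, e = s(u, v) ∧ u ∈ σ ∧ v ∉ σ).card : ℝ) := by
  have hA : (G.adjMatrix ℝ).IsHermitian := G.isHermitian_adjMatrix ℝ
  have hroots : ∀ g : Fin n → ℝ, (∏ i, (X - C (g i))).roots = Finset.univ.val.map g := by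
    intro g
    rw [← roots_multiset_prod_X_sub_C (Finset.univ.val.map g), Multiset.map_map]
    rfl
  have hms : Finset.univ.val.map μ = Finset.univ.val.map hA.eigenvalues := by
    rw [← hroots, ← hroots, ← hc, hA.charpoly_eq]
    rfl
  obtain ⟨e, he⟩ := aux_equiv _ _ hms
  let c : Fin k → Fin n := fun j => e (Fin.castLE hkn j)
  have hcinj : Function.Injective c := e.injective.comp (Fin.castLE_injective hkn)
  let U : Matrix (Fin n) (Fin n) ℝ := hA.eigenvectorUnitary
  have hU : Uᵀ * U = 1 := by
    have := Unitary.coe_star_mul_self hA.eigenvectorUnitary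
    rwa [star_eq_conjTranspose, conjTranspose_eq_transpose_of_trivial] at this
  obtain ⟨σ, hσ, hle⟩ := aux_main G (U.submatrix id c) (fun j => μ (Fin.castLE hkn j))
    (by
      ext i j
      have := congrFun (congrFun hU (c i)) (c j)
      simp only [Matrix.mul_apply, transpose_apply, submatrix_apply, id_eq, Matrix.one_apply,
        hcinj.eq_iff] at this ⊢
      exact this)
    (by
      intro u i
      have := congrFun (hA.mulVec_eigenvectorBasis (c i)) u
      rw [he]
      simpa [Matrix.mul_apply, mulVec, dotProduct, U, c,
        IsHermitian.eigenvectorUnitary_apply] using this)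
  have hsum : ∑ i ∈ Finset.univ.filter (fun i : Fin n => (i : ℕ) < k), μ i
      = ∑ j : Fin k, μ (Fin.castLE hkn j) := by
    symm
    refine Finset.sum_bij (fun j _ => Fin.castLE hkn j) ?_ ?_ ?_ ?_
    · intro j _
      simp
    · intro a _ b _ h
      exact Fin.castLE_injective hkn h
    · intro b hb
      exact ⟨⟨b, by simpa using hb⟩, Finset.mem_univ _, rfl⟩
    · intro _ _
      rfl
  rw [hsum]
  refine hle.trans ?_
  exact Finset.le_sup' (fun σ : Finset (Fin n) => ((G.edgeFinset.filter fun e =>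
          ∃ u v : Fin n, e = s(u, v) ∧ u ∈ σ ∧ v ∉ σ).card : ℝ))
    (Finset.mem_powersetCard.mpr ⟨Finset.subset_univ _, hσ⟩)
end
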